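/- Let n ≥ 2, fix signs ε_1,…,ε_n ∈ {1,−1}, and let m ≥ 3 with n(m−1) ≥ 6. For every σ ≥ 0 there is a constant C > 0 such that for every φ ∈ Ḃ^σ_{2,1}(ℝⁿ), the free evolution satisfies ‖W_±(t)φ‖_{Ż^σ_{2,1}} ≤ C ‖φ‖_{Ḃ^σ_{2,1}}, where the left-hand side is the Ż^σ_{2,1} norm of the space-time function (t,x) ↦ (W_±(t)φ)(x). -/

import Mathlib

open MeasureTheory Complex Filter
open scoped FourierTransform RealInnerProductSpace ENNReal NNReal Topology

noncomputable section

namespace DNLS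

/-- Euclidean space ℝⁿ. -/
abbrev Eucl (n : ℕ) := EuclideanSpace ℝ (Fin n)

/-- The quadratic symbol `|ξ|²_± = Σ εᵢ ξᵢ²`. -/
def quadSym {n : ℕ} (ε : Fin n → ℝ) (ξ : Eucl n) : ℝ := ∑ i, ε i * (ξ i) ^ 2

/-- The signed vector `e_± = (ε₁e₁, …, εₙeₙ)`. -/
def epm {n : ℕ} (ε : Fin n → ℝ) (e : Eucl n) : Eucl n := WithLp.toLp 2 (fun i => ε i * e i)

/-- Fourier multiplier operator with symbol `m`. -/
def mulOp {n : ℕ} (m : Eucl n → ℂ) (f : Eucl n → ℂ) : Eucl n → ℂ :=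
  𝓕⁻ (fun ξ => m ξ * 𝓕 f ξ)

/-- The propagator `W_±(t)`, with `(W_±(t)φ)^(ξ) = e^{-it|ξ|²_±} φ̂(ξ)`. -/
def prop {n : ℕ} (ε : Fin n → ℝ) (t : ℝ) (φ : Eucl n → ℂ) : Eucl n → ℂ :=
  mulOp (fun ξ => Complex.exp (-Complex.I * t * quadSym ε ξ)) φ

/-- Fourier multiplier operator acting in the space variable of a space-time function. -/
def mulOpT {n : ℕ} (m : Eucl n → ℂ) (u : ℝ × Eucl n → ℂ) : ℝ × Eucl n → ℂ :=
  fun p => mulOp m (fun y => u (p.1, y)) p.2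

/-- Hypotheses on the bump function χ : even, smooth, compactly supported in (-2,2),
equal to one on [-1,1]. -/
structure IsBump (χ : ℝ → ℝ) : Prop where
  smooth : ∀ k : ℕ, ContDiff ℝ k χ
  even : ∀ s, χ (-s) = χ s
  supp : ∀ s, 2 ≤ |s| → χ s = 0
  one : ∀ s, |s| ≤ 1 → χ s = 1

/-- `ψ(s) = χ(|s|) - χ(2|s|)`. -/
def psiR (χ : ℝ → ℝ) (s : ℝ) : ℝ := χ |s| - χ (2 * |s|)

/-- `ψ_{≥k}(s) = Σ_{m ≥ k} ψ(2^{-m} s)`. -/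
def psiGe (χ : ℝ → ℝ) (k : ℤ) (s : ℝ) : ℝ :=
  ∑' m : ℤ, if k ≤ m then psiR χ ((2 : ℝ) ^ (-m) * s) else 0

/-- Littlewood–Paley projection `P_j`. -/
def proj {n : ℕ} (χ : ℝ → ℝ) (j : ℤ) (f : Eucl n → ℂ) : Eucl n → ℂ :=
  mulOp (fun ξ => (psiR χ ((2 : ℝ) ^ (-j) * ‖ξ‖) : ℂ)) f

/-- Low-frequency projection `P_{≤0} = I - Σ_{j≥1} P_j`. -/
def lowProj {n : ℕ} (χ : ℝ → ℝ) (f : Eucl n → ℂ) : Eucl n → ℂ :=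
  mulOp (fun ξ => ((1 - psiGe χ 1 ‖ξ‖ : ℝ) : ℂ)) f

/-- Directional frequency cutoff `Q^{e}_{j,l}` with symbol `ψ_{≥ j-l}(ξ·e)`. -/
def qproj {n : ℕ} (χ : ℝ → ℝ) (e : Eucl n) (j l : ℤ) (f : Eucl n → ℂ) : Eucl n → ℂ :=
  mulOp (fun ξ => ((psiGe χ (j - l) (inner ℝ ξ e : ℝ) : ℝ) : ℂ)) f

/-- `P_j` acting in the space variable of a space-time function. -/
def projT {n : ℕ} (χ : ℝ → ℝ) (j : ℤ) (u : ℝ × Eucl n → ℂ) : ℝ × Eucl n → ℂ :=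
  fun p => proj χ j (fun y => u (p.1, y)) p.2

/-- `P_{≤0}` acting in the space variable of a space-time function. -/
def lowProjT {n : ℕ} (χ : ℝ → ℝ) (u : ℝ × Eucl n → ℂ) : ℝ × Eucl n → ℂ :=
  fun p => lowProj χ (fun y => u (p.1, y)) p.2

/-- `Q^{e}_{j,l}` acting in the space variable of a space-time function. -/
def qprojT {n : ℕ} (χ : ℝ → ℝ) (e : Eucl n) (j l : ℤ) (u : ℝ × Eucl n → ℂ) :
    ℝ × Eucl n → ℂ :=
  fun p => qproj χ e j l (fun y => u (p.1, y)) p.2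

/-- The hyperplane `P_e = {ξ : ξ·e = 0}`. -/
def hyperplane {n : ℕ} (e : Eucl n) : Submodule ℝ (Eucl n) := (ℝ ∙ e)ᗮ

/-- Inner part of the anisotropic norm: the `L^q` norm over `P_e × ℝ` of
`(t,v) ↦ u(t, re + v)`. -/
def innerQ {n : ℕ} (q : ℝ≥0∞) (e : Eucl n) (u : ℝ × Eucl n → ℂ) (r : ℝ) : ℝ≥0∞ :=
  eLpNorm (fun tv : ℝ × (hyperplane e) => u (tv.1, r • e + (tv.2 : Eucl n))) q volume

/-- The anisotropic norm `‖u‖_{L^{p,q}_e}`. -/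
def aniNorm {n : ℕ} (p q : ℝ≥0∞) (e : Eucl n) (u : ℝ × Eucl n → ℂ) : ℝ≥0∞ :=
  if p = ∞ then essSup (innerQ q e u) volume
  else (∫⁻ r : ℝ, innerQ q e u r ^ p.toReal) ^ (1 / p.toReal)

/-- The mixed space-time norm `‖u‖_{L^q_t L^r_x}`. -/
def mixNorm {n : ℕ} (q r : ℝ≥0∞) (u : ℝ × Eucl n → ℂ) : ℝ≥0∞ :=
  if q = ∞ then essSup (fun t => eLpNorm (fun x => u (t, x)) r volume) volume
  else (∫⁻ t : ℝ, eLpNorm (fun x => u (t, x)) r volume ^ q.toReal) ^ (1 / q.toReal)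

/-- `2^a` as an extended nonnegative real. -/
def tp (a : ℝ) : ℝ≥0∞ := ENNReal.ofReal ((2 : ℝ) ^ a)

/-- Homogeneous Besov norm `‖φ‖_{Ḃ^s_{2,1}}`. -/
def homBesov {n : ℕ} (χ : ℝ → ℝ) (s : ℝ) (φ : Eucl n → ℂ) : ℝ≥0∞ :=
  ∑' j : ℤ, tp (s * j) * eLpNorm (proj χ j φ) 2 volume

/-- Inhomogeneous Besov norm `‖φ‖_{B^s_{2,1}}`. -/
def besov {n : ℕ} (χ : ℝ → ℝ) (s : ℝ) (φ : Eucl n → ℂ) : ℝ≥0∞ :=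
  eLpNorm (lowProj χ φ) 2 volume
    + ∑' j : ℕ, tp (s * (j + 1)) * eLpNorm (proj χ (j + 1) φ) 2 volume

/-- The supremum over unit vectors, auxiliary notation. -/
def sphSup {n : ℕ} (g : Eucl n → ℝ≥0∞) : ℝ≥0∞ := ⨆ (e : Eucl n) (_ : ‖e‖ = 1), g e

/-- `‖P_j u‖_{M^m_j} = 2^{-(n/2-1/(m-1))j} sup_e ‖P_j u‖_{L^{m-1,∞}_e}`. -/
def MmJ {n : ℕ} (χ : ℝ → ℝ) (m : ℕ) (j : ℤ) (u : ℝ × Eucl n → ℂ) : ℝ≥0∞ :=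
  tp (-((n : ℝ) / 2 - 1 / ((m : ℝ) - 1)) * j)
    * sphSup (fun e => aniNorm ((m : ℝ≥0∞) - 1) ∞ e (projT χ j u))

/-- `‖P_j u‖_{S_j} = 2^{j/2} sup_e ‖P_j Q^{e_±}_{j,20} u‖_{L^{∞,2}_e}`. -/
def SJ {n : ℕ} (ε : Fin n → ℝ) (χ : ℝ → ℝ) (j : ℤ) (u : ℝ × Eucl n → ℂ) : ℝ≥0∞ :=
  tp ((j : ℝ) / 2)
    * sphSup (fun e => aniNorm ∞ 2 e (projT χ j (qprojT χ (epm ε e) j 20 u)))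

/-- `‖P_j u‖_{T_j} = ‖P_j u‖_{L^∞_t L²_x}`. -/
def TJ {n : ℕ} (χ : ℝ → ℝ) (j : ℤ) (u : ℝ × Eucl n → ℂ) : ℝ≥0∞ :=
  mixNorm ∞ 2 (projT χ j u)

/-- `‖P_j u‖_{Y^m_j}`. -/
def YmJ {n : ℕ} (ε : Fin n → ℝ) (χ : ℝ → ℝ) (m : ℕ) (j : ℤ) (u : ℝ × Eucl n → ℂ) : ℝ≥0∞ :=
  MmJ χ m j u + SJ ε χ j u + TJ χ j u

/-- The homogeneous resolution norm `‖u‖_{Ż^σ_{2,1}}`. -/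
def Zhom {n : ℕ} (ε : Fin n → ℝ) (χ : ℝ → ℝ) (m : ℕ) (σ : ℝ) (u : ℝ × Eucl n → ℂ) : ℝ≥0∞ :=
  ∑' j : ℤ, tp (σ * j) * YmJ ε χ m j u

/-- `N_j`-norm of a function: `2^{-j/2} sup_e ‖f‖_{L^{1,2}_e}`. -/
def NJraw {n : ℕ} (j : ℤ) (f : ℝ × Eucl n → ℂ) : ℝ≥0∞ :=
  tp (-(j : ℝ) / 2) * sphSup (fun e => aniNorm 1 2 e f)

/-- `‖P_j u‖_{N_j}`. -/
def NJ {n : ℕ} (χ : ℝ → ℝ) (j : ℤ) (u : ℝ × Eucl n → ℂ) : ℝ≥0∞ :=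
  NJraw j (projT χ j u)

/-- The homogeneous nonlinear norm `‖F‖_{Ṅ^σ_{2,1}}`. -/
def Nhom {n : ℕ} (χ : ℝ → ℝ) (σ : ℝ) (F : ℝ × Eucl n → ℂ) : ℝ≥0∞ :=
  ∑' j : ℤ, tp (σ * j) * NJ χ j F

/-- `‖P_j u‖_{T̃_j} = ‖P_j u‖_{L^∞_t L²_x} + ‖P_j u‖_{L^{2+4/n}_{t,x}}`. -/
def TtilJ {n : ℕ} (χ : ℝ → ℝ) (j : ℤ) (u : ℝ × Eucl n → ℂ) : ℝ≥0∞ :=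
  mixNorm ∞ 2 (projT χ j u)
    + eLpNorm (projT χ j u) (ENNReal.ofReal (2 + 4 / (n : ℝ))) volume

/-- `‖P_j u‖_{M̃_j} = sup_{p ∈ ℤ, p ≥ 2, np ≥ 6} sup_e 2^{(n/2-1/p)j}‖P_j u‖_{L^{p,∞}_e}`. -/
def MtilJ {n : ℕ} (χ : ℝ → ℝ) (j : ℤ) (u : ℝ × Eucl n → ℂ) : ℝ≥0∞ :=
  ⨆ (p : ℕ) (_ : 2 ≤ p ∧ 6 ≤ n * p),
    sphSup (fun e => tp (((n : ℝ) / 2 - 1 / (p : ℝ)) * j) * aniNorm (p : ℝ≥0∞) ∞ e (projT χ j u))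

/-- `‖P_j u‖_{Ỹ_j}`. -/
def YtilJ {n : ℕ} (ε : Fin n → ℝ) (χ : ℝ → ℝ) (j : ℤ) (u : ℝ × Eucl n → ℂ) : ℝ≥0∞ :=
  MtilJ χ j u + SJ ε χ j u + TtilJ χ j u

/-- The inhomogeneous resolution norm `‖u‖_{Z̃^σ_{2,1}}`. -/
def Ztil {n : ℕ} (ε : Fin n → ℝ) (χ : ℝ → ℝ) (σ : ℝ) (u : ℝ × Eucl n → ℂ) : ℝ≥0∞ :=
  (∑' j : ℤ, if j ≤ 0 then YtilJ ε χ j u ^ 2 else 0) ^ ((1 : ℝ) / 2)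
    + ∑' j : ℤ, if 1 ≤ j then tp (σ * j) * YtilJ ε χ j u else 0

/-- `‖f‖_{Ñ_j}`: infimum over decompositions `f = v + w`. -/
def NtilJraw {n : ℕ} (j : ℤ) (f : ℝ × Eucl n → ℂ) : ℝ≥0∞ :=
  ⨅ (vw : (ℝ × Eucl n → ℂ) × (ℝ × Eucl n → ℂ)) (_ : f = vw.1 + vw.2),
    NJraw j vw.1 + eLpNorm vw.2 (ENNReal.ofReal ((2 * (n : ℝ) + 4) / ((n : ℝ) + 4))) volume

/-- The inhomogeneous nonlinear norm `‖F‖_{Ñ^σ_{2,1}}`. -/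
def Ntil {n : ℕ} (χ : ℝ → ℝ) (σ : ℝ) (F : ℝ × Eucl n → ℂ) : ℝ≥0∞ :=
  (∑' j : ℤ, if j ≤ 0 then NtilJraw j (projT χ j F) ^ 2 else 0) ^ ((1 : ℝ) / 2)
    + ∑' j : ℤ, if 1 ≤ j then tp (σ * j) * NtilJraw j (projT χ j F) else 0

/-- `k`-th spatial partial derivative of a space-time function. -/
def pd {n : ℕ} (k : ℕ) (u : ℝ × Eucl n → ℂ) (p : ℝ × Eucl n) : ℂ :=
  if h : k < n then fderiv ℝ (fun y => u (p.1, y)) p.2 (EuclideanSpace.single ⟨k, h⟩ (1 : ℝ))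
  else 0

/-- The retarded Duhamel integral `∫_0^t W_±(t-s) G(s) ds`. -/
def duhamel {n : ℕ} (ε : Fin n → ℝ) (G : ℝ × Eucl n → ℂ) (p : ℝ × Eucl n) : ℂ :=
  ∫ s in (0 : ℝ)..p.1, prop ε (p.1 - s) (fun y => G (s, y)) p.2

/-- Admissible Strichartz pair: `2/q = n(1/2 - 1/r)`, `q, r ≥ 2`, and `q ≠ 2` when `n = 2`. -/
def Admissible (n : ℕ) (q r : ℝ) : Prop :=
  2 / q = (n : ℝ) * (1 / 2 - 1 / r) ∧ 2 ≤ q ∧ 2 ≤ r ∧ (n = 2 → q ≠ 2)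

/-- Value of a power series with coefficients `c` at `z`. -/
def polyVal {d : ℕ} (c : (Fin d →₀ ℕ) → ℂ) (z : Fin d → ℂ) : ℂ :=
  ∑' β : Fin d →₀ ℕ, c β * ∏ i, z i ^ β i

/-- The argument vector `(u, ū, ∇u, ∇ū)` of the general nonlinearity. -/
def nlArg {n : ℕ} (u : ℝ × Eucl n → ℂ) (p : ℝ × Eucl n) (i : Fin (2 * n + 2)) : ℂ :=
  if (i : ℕ) = 0 then u p
  else if (i : ℕ) = 1 then starRingEnd ℂ (u p)
  else if (i : ℕ) < n + 2 then pd ((i : ℕ) - 2) u p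
  else pd ((i : ℕ) - (n + 2)) (fun q => starRingEnd ℂ (u q)) p

/-- The argument vector `(∇u, ∇ū)` of a nonlinearity in `2n` variables. -/
def gradArg {n : ℕ} (u : ℝ × Eucl n → ℂ) (p : ℝ × Eucl n) (i : Fin (2 * n)) : ℂ :=
  if (i : ℕ) < n then pd (i : ℕ) u p
  else pd ((i : ℕ) - n) (fun q => starRingEnd ℂ (u q)) p

end DNLS
open DNLS

namespace DNLS

section Plancherel

variable {V : Type*} [NormedAddCommGroup V] [InnerProductSpace ℝ V] [FiniteDimensional ℝ V]
  [MeasurableSpace V] [BorelSpace V]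

lemma continuous_fourier_of_integrable {f : V → ℂ} (hf : Integrable f) : Continuous (𝓕 f) :=
  VectorFourier.fourierIntegral_continuous Real.continuous_fourierChar
    (by exact continuous_inner) hf

/-- Plancherel's theorem for the integral Fourier transform on `L¹ ∩ L²`. -/
lemma eLpNorm_fourier_eq {f : V → ℂ} (h1 : Integrable f) (h2 : MemLp f 2) :
    eLpNorm (𝓕 f) 2 volume = eLpNorm f 2 volume := by
  set F : Lp ℂ 2 (volume : Measure V) := h2.toLp f
  have key : ∀ᵐ x, 𝓕 f x = (𝓕 F : Lp ℂ 2 (volume : Measure V)) x := by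
    refine ae_eq_of_integral_contDiff_smul_eq
      (continuous_fourier_of_integrable h1).locallyIntegrable
      ((Lp.memLp (𝓕 F)).locallyIntegrable (by norm_num)) ?_
    intro g hg hgs
    have hgs' : HasCompactSupport (fun x => (g x : ℂ)) := hgs.comp_left (g := ofReal) rfl
    have hg' : ContDiff ℝ (⊤ : ℕ∞) (fun x => (g x : ℂ)) := ofRealCLM.contDiff.comp hg
    set G : SchwartzMap V ℂ := hgs'.toSchwartzMap hg'
    have hG : ∀ x, G x = (g x : ℂ) := fun x => rfl
    have e1 := congrArg (fun T => T G) (Lp.fourier_toTemperedDistribution_eq F)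
    simp only [TemperedDistribution.fourier_apply, Lp.toTemperedDistribution_apply,
      smul_eq_mul] at e1
    have e2 : ∫ x, (𝓕 G) x * F x = ∫ x, (𝓕 G) x * f x := by
      refine integral_congr_ae ?_
      filter_upwards [h2.coeFn_toLp] with x hx
      rw [hx]
    rw [e2] at e1
    have e3 := VectorFourier.integral_fourierIntegral_smul_eq_flip (μ := (volume : Measure V))
      (ν := (volume : Measure V)) (f := G)
      (g := f) (L := innerₗ V) Real.continuous_fourierChar (by exact continuous_inner)
      G.integrable h1
    have e4 : ∫ x, (𝓕 G) x * f x = ∫ x, G x * 𝓕 f x := by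
      rw [flip_innerₗ] at e3
      exact e3
    rw [e4] at e1
    simpa [hG, real_smul] using e1
  calc eLpNorm (𝓕 f) 2 volume = eLpNorm (𝓕 F : Lp ℂ 2 (volume : Measure V)) 2 volume :=
        eLpNorm_congr_ae key
    _ = ‖𝓕 F‖ₑ := (Lp.enorm_def _).symm
    _ = ‖F‖ₑ := by rw [← ofReal_norm, Lp.norm_fourier_eq, ofReal_norm]
    _ = eLpNorm f 2 volume := by rw [Lp.enorm_def]; exact eLpNorm_congr_ae h2.coeFn_toLp

lemma eLpNorm_fourierInv_eq {f : V → ℂ} (h1 : Integrable f) (h2 : MemLp f 2) :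
    eLpNorm (𝓕⁻ f) 2 volume = eLpNorm f 2 volume := by
  rw [← eLpNorm_fourier_eq h1 h2]
  have : 𝓕⁻ f = 𝓕 f ∘ (fun x => -x) := by
    ext x; exact Real.fourierInv_eq_fourier_neg f x
  rw [this]
  exact eLpNorm_comp_measurePreserving
    (continuous_fourier_of_integrable h1).aestronglyMeasurable (Measure.measurePreserving_neg _)

end Plancherel

lemma lintegral_enorm_sq_eq_eLpNorm {α : Type*} [MeasurableSpace α] (μ : Measure α) (f : α → ℂ) :
    ∫⁻ x, ‖f x‖ₑ ^ 2 ∂μ = eLpNorm f 2 μ ^ 2 := by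
  rw [eLpNorm_eq_lintegral_rpow_enorm_toReal (by norm_num) (by norm_num), ← ENNReal.rpow_natCast,
    ← ENNReal.rpow_mul]
  norm_num

lemma lintegral_comp_mul_left_real {a : ℝ} (ha : a ≠ 0) (f : ℝ → ℝ≥0∞) :
    ∫⁻ t, f (a * t) = ENNReal.ofReal |a⁻¹| * ∫⁻ t, f t := by
  have hemb : MeasurableEmbedding (fun t : ℝ => a * t) :=
    (Homeomorph.mulLeft₀ a ha).measurableEmbedding
  rw [← hemb.lintegral_map (μ := volume) (f := f), Real.map_volume_mul_left ha,
    lintegral_smul_measure, smul_eq_mul]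

/-- `L²` bound for an oscillatory integral with an injective phase whose derivative is bounded
below. -/
lemma lintegral_phase_le_of_injOn {S : Set ℝ} (hS : MeasurableSet S) {q q' : ℝ → ℝ}
    (hq : ∀ x ∈ S, HasDerivWithinAt q (q' x) S x) (hinj : Set.InjOn q S)
    {δ : ℝ} (hδ : 0 < δ) (hqδ : ∀ x ∈ S, δ ≤ |q' x|) {f : ℝ → ℂ} (hf1 : IntegrableOn f S)
    (hf2 : ∫⁻ x in S, ‖f x‖ₑ ^ 2 < ∞) :
    ∫⁻ t : ℝ, ‖∫ x in S, cexp (-I * t * q x) * f x‖ₑ ^ 2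
      ≤ ENNReal.ofReal (2 * Real.pi / δ) * ∫⁻ x in S, ‖f x‖ₑ ^ 2 := by
  set p := Function.invFunOn q S with hp
  have hpq : ∀ x ∈ S, p (q x) = x := fun x hx => hinj.leftInvOn_invFunOn hx
  set g : ℝ → ℂ := fun w => f (p w) / (|q' (p w)| : ℝ) with hg
  set G : ℝ → ℂ := (q '' S).indicator g with hG
  have hqS : MeasurableSet (q '' S) :=
    hS.image_of_continuousOn_injOn (fun x hx => (hq x hx).continuousWithinAt) hinj
  have hq0 : ∀ x ∈ S, (|q' x| : ℝ) ≠ 0 := fun x hx => (hδ.trans_le (hqδ x hx)).ne'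
  have hgq : ∀ x ∈ S, |q' x| • g (q x) = f x := fun x hx => by
    simp only [hg, hpq x hx, real_smul]
    rw [mul_div_cancel₀]
    exact_mod_cast hq0 x hx
  have hgi : IntegrableOn g (q '' S) := by
    rw [integrableOn_image_iff_integrableOn_abs_deriv_smul hS hq hinj]
    exact hf1.congr_fun (fun x hx => (hgq x hx).symm) hS
  have hGi : Integrable G := (integrable_indicator_iff hqS).2 hgi
  have hG2 : ∫⁻ w, ‖G w‖ₑ ^ 2 ≤ ENNReal.ofReal (1 / δ) * ∫⁻ x in S, ‖f x‖ₑ ^ 2 := by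
    have : ∀ w, ‖G w‖ₑ ^ 2 = (q '' S).indicator (fun w => ‖g w‖ₑ ^ 2) w := fun w => by
      by_cases h : w ∈ q '' S <;> simp [hG, h]
    simp_rw [this]
    rw [lintegral_indicator hqS, lintegral_image_eq_lintegral_abs_deriv_mul hS hq hinj,
      ← lintegral_const_mul' _ _ ENNReal.ofReal_ne_top]
    refine setLIntegral_mono' hS fun x hx => ?_
    have hx0 := hq0 x hx
    have h1 : ‖g (q x)‖ₑ = ENNReal.ofReal (|q' x|⁻¹) * ‖f x‖ₑ := by
      rw [← hgq x hx, enorm_smul, ← mul_assoc, Real.enorm_eq_ofReal (abs_nonneg _),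
        ← ENNReal.ofReal_mul (by positivity), inv_mul_cancel₀ hx0]
      simp
    rw [h1, mul_pow, ← mul_assoc, ← ENNReal.ofReal_pow (by positivity),
      ← ENNReal.ofReal_mul (by positivity)]
    gcongr
    rw [sq, ← mul_assoc, mul_inv_cancel₀ hx0, one_mul, one_div]
    exact inv_anti₀ hδ (hqδ x hx)
  have hGm : MemLp G 2 := by
    refine ⟨hGi.aestronglyMeasurable, ?_⟩
    have : eLpNorm G 2 volume ^ 2 < ∞ := by
      rw [← lintegral_enorm_sq_eq_eLpNorm]
      exact hG2.trans_lt (ENNReal.mul_lt_top ENNReal.ofReal_lt_top hf2)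
    simpa using this
  have hA : ∀ t : ℝ, ∫ x in S, cexp (-I * t * q x) * f x = 𝓕 G ((2 * Real.pi)⁻¹ * t) := fun t => by
    have e1 : ∀ w, cexp (↑(-2 * Real.pi * w * ((2 * Real.pi)⁻¹ * t)) * I) • G w
        = (q '' S).indicator (fun w => cexp (-I * t * w) * g w) w := fun w => by
      have : (↑(-2 * Real.pi * w * ((2 * Real.pi)⁻¹ * t)) * I : ℂ) = -I * t * w := by
        push_cast
        have : (Real.pi : ℂ) ≠ 0 := by exact_mod_cast Real.pi_ne_zero
        field_simp
      rw [this]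
      by_cases h : w ∈ q '' S <;> simp [hG, h]
    rw [Real.fourier_real_eq_integral_exp_smul]
    simp_rw [e1]
    rw [integral_indicator hqS, integral_image_eq_integral_abs_deriv_smul hS hq hinj]
    refine setIntegral_congr_fun hS fun x hx => ?_
    rw [← hgq x hx]
    simp only [real_smul]
    ring
  simp_rw [hA]
  rw [lintegral_comp_mul_left_real (by positivity) (fun s => ‖𝓕 G s‖ₑ ^ 2),
    lintegral_enorm_sq_eq_eLpNorm, eLpNorm_fourier_eq hGi hGm, ← lintegral_enorm_sq_eq_eLpNorm]
  calc _ ≤ ENNReal.ofReal |((2 * Real.pi)⁻¹)⁻¹|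
        * (ENNReal.ofReal (1 / δ) * ∫⁻ x in S, ‖f x‖ₑ ^ 2) := by gcongr
    _ = _ := by
      rw [← mul_assoc, ← ENNReal.ofReal_mul (abs_nonneg _), inv_inv, abs_of_pos (by positivity),
        mul_one_div]

lemma add_sq_le_two_mul (a b : ℝ≥0∞) : (a + b) ^ 2 ≤ 2 * (a ^ 2 + b ^ 2) := by
  have := ENNReal.rpow_add_le_mul_rpow_add_rpow a b (p := 2) (by norm_num)
  norm_num at this
  exact this

/-- `L²` bound for an oscillatory integral with quadratic phase. -/
lemma lintegral_quadratic_phase_le (a b c : ℝ) {δ : ℝ} (hδ : 0 < δ) {f : ℝ → ℂ}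
    (hf1 : Integrable f) (hf2 : ∫⁻ x, ‖f x‖ₑ ^ 2 < ∞)
    (hsupp : ∀ x, f x ≠ 0 → δ ≤ |2 * (a * x + b)|) :
    ∫⁻ t : ℝ, ‖∫ x, cexp (-I * t * (a * x ^ 2 + 2 * b * x + c : ℝ)) * f x‖ₑ ^ 2
      ≤ ENNReal.ofReal (4 * Real.pi / δ) * ∫⁻ x, ‖f x‖ₑ ^ 2 := by
  set q : ℝ → ℝ := fun x => a * x ^ 2 + 2 * b * x + c with hq
  set q' : ℝ → ℝ := fun x => 2 * (a * x + b) with hq'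
  have hq'c : Continuous q' := by fun_prop
  have hder : ∀ x, HasDerivAt q (q' x) x := fun x => by
    have := (((hasDerivAt_pow 2 x).const_mul a).add ((hasDerivAt_id x).const_mul (2 * b))).add_const c
    convert! this using 1
    simp [hq']; ring
  set P : Set ℝ := {x | δ ≤ q' x}
  set N : Set ℝ := {x | δ ≤ -q' x}
  have hP : MeasurableSet P := measurableSet_le measurable_const hq'c.measurable
  have hN : MeasurableSet N := measurableSet_le measurable_const hq'c.neg.measurable
  have hfac : ∀ x y, q x - q y = (x - y) * (q' x + q' y) / 2 := fun x y => by
    simp only [hq, hq']; ring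
  have hPi : Set.InjOn q P := fun x hx y hy h => by
    have h1 := hfac x y
    have hx : δ ≤ q' x := hx
    have hy : δ ≤ q' y := hy
    have : (x - y) * (q' x + q' y) = 0 := by linarith
    rcases mul_eq_zero.1 this with h | h <;> linarith
  have hNi : Set.InjOn q N := fun x hx y hy h => by
    have h1 := hfac x y
    have hx : δ ≤ -q' x := hx
    have hy : δ ≤ -q' y := hy
    have : (x - y) * (q' x + q' y) = 0 := by linarith
    rcases mul_eq_zero.1 this with h | h <;> linarith
  have hdisj : Disjoint P N := Set.disjoint_left.2 fun x hx hy => by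
    have hx : δ ≤ q' x := hx
    have hy : δ ≤ -q' x := hy
    linarith
  have hzero : ∀ x ∉ P ∪ N, f x = 0 := fun x hx => by
    by_contra h
    refine hx ?_
    rcases le_abs.1 (hsupp x h) with h | h
    · exact Or.inl h
    · exact Or.inr h
  have hint : ∀ t : ℝ, Integrable fun x => cexp (-I * t * q x) * f x := fun t => by
    refine hf1.bdd_mul (c := 1) (by fun_prop) (Eventually.of_forall fun x => ?_)
    have : -I * t * q x = (-t * q x : ℝ) * I := by push_cast; ring
    rw [this, norm_exp_ofReal_mul_I]
  have hsplit : ∀ t : ℝ, ∫ x, cexp (-I * t * q x) * f x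
      = (∫ x in P, cexp (-I * t * q x) * f x) + ∫ x in N, cexp (-I * t * q x) * f x := fun t => by
    rw [← setIntegral_union hdisj hN (hint t).integrableOn (hint t).integrableOn,
      setIntegral_eq_integral_of_forall_compl_eq_zero]
    intro x hx
    rw [hzero x hx, mul_zero]
  have hlt : ∀ S : Set ℝ, ∫⁻ x in S, ‖f x‖ₑ ^ 2 < ∞ := fun S =>
    (setLIntegral_le_lintegral _ _).trans_lt hf2
  have eP := lintegral_phase_le_of_injOn hP (fun x _ => (hder x).hasDerivWithinAt) hPi hδ
    (fun x hx => le_trans hx (le_abs_self _)) hf1.integrableOn (hlt P)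
  have eN := lintegral_phase_le_of_injOn hN (fun x _ => (hder x).hasDerivWithinAt) hNi hδ
    (fun x hx => le_trans hx (neg_le_abs _)) hf1.integrableOn (hlt N)
  have hm : Measurable fun t : ℝ => ‖∫ x in P, cexp (-I * t * q x) * f x‖ₑ ^ 2 := by
    refine Measurable.pow_const (Continuous.enorm ?_).measurable _
    refine continuous_of_dominated (bound := fun x => ‖f x‖)
      (fun t => (hint t).aestronglyMeasurable.restrict)
      (fun t => Eventually.of_forall fun x => ?_) hf1.norm.integrableOn
      (Eventually.of_forall fun x => by fun_prop)
    have : -I * t * q x = (-t * q x : ℝ) * I := by push_cast; ring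
    rw [norm_mul, this, norm_exp_ofReal_mul_I, one_mul]
  calc ∫⁻ t : ℝ, ‖∫ x, cexp (-I * t * q x) * f x‖ₑ ^ 2
      ≤ ∫⁻ t : ℝ, 2 * (‖∫ x in P, cexp (-I * t * q x) * f x‖ₑ ^ 2
          + ‖∫ x in N, cexp (-I * t * q x) * f x‖ₑ ^ 2) := by
        refine lintegral_mono fun t => ?_
        simp only [hsplit]
        refine le_trans ?_ (add_sq_le_two_mul _ _)
        gcongr
        exact enorm_add_le _ _
    _ ≤ 2 * (ENNReal.ofReal (2 * Real.pi / δ) * (∫⁻ x in P, ‖f x‖ₑ ^ 2)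
          + ENNReal.ofReal (2 * Real.pi / δ) * (∫⁻ x in N, ‖f x‖ₑ ^ 2)) := by
        rw [lintegral_const_mul' _ _ (by norm_num), lintegral_add_left hm]
        gcongr
    _ = 2 * ENNReal.ofReal (2 * Real.pi / δ) * ∫⁻ x in P ∪ N, ‖f x‖ₑ ^ 2 := by
        rw [lintegral_union hN hdisj]; ring
    _ ≤ _ := by
        gcongr
        · rw [← ENNReal.ofReal_ofNat, ← ENNReal.ofReal_mul (by norm_num)]
          apply le_of_eq; congr 1; ring
        · exact Measure.restrict_le_self

/-- The free evolution with frequency profile `h`. -/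
def freeEvo {n : ℕ} (ε : Fin n → ℝ) (h : Eucl n → ℂ) (p : ℝ × Eucl n) : ℂ :=
  𝓕⁻ (fun ξ => cexp (-I * p.1 * quadSym ε ξ) * h ξ) p.2

section Geometry

variable {n : ℕ}

/-- Orthogonal coordinates `(ρ, η) ↦ ρ e + η` adapted to the unit vector `e`. -/
def orthCoord (e : Eucl n) (z : ℝ × hyperplane e) : Eucl n := z.1 • e + (z.2 : Eucl n)

lemma continuous_orthCoord (e : Eucl n) : Continuous (orthCoord e) := by
  unfold orthCoord; fun_prop

lemma inner_hyperplane (e : Eucl n) (v : hyperplane e) : ⟪e, (v : Eucl n)⟫ = 0 :=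
  Submodule.mem_orthogonal_singleton_iff_inner_right.1 v.2

lemma inner_orthCoord {e : Eucl n} (he : ‖e‖ = 1) (z w : ℝ × hyperplane e) :
    ⟪orthCoord e z, orthCoord e w⟫ = z.1 * w.1 + ⟪z.2, w.2⟫ := by
  have h1 := inner_hyperplane e w.2
  have h2 : ⟪(z.2 : Eucl n), e⟫ = 0 := by rw [real_inner_comm]; exact inner_hyperplane e z.2
  simp only [orthCoord, inner_add_left, inner_add_right, real_inner_smul_left,
    real_inner_smul_right, h1, h2, real_inner_self_eq_norm_sq, he, Submodule.coe_inner]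
  ring

lemma norm_sq_orthCoord {e : Eucl n} (he : ‖e‖ = 1) (z : ℝ × hyperplane e) :
    ‖orthCoord e z‖ ^ 2 = z.1 ^ 2 + ‖z.2‖ ^ 2 := by
  rw [← real_inner_self_eq_norm_sq, inner_orthCoord he, real_inner_self_eq_norm_sq, sq z.1]

lemma abs_fst_le_norm_orthCoord {e : Eucl n} (he : ‖e‖ = 1) (z : ℝ × hyperplane e) :
    |z.1| ≤ ‖orthCoord e z‖ :=
  abs_le_of_sq_le_sq (by rw [norm_sq_orthCoord he]; nlinarith [sq_nonneg ‖z.2‖])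
    (norm_nonneg _)

lemma norm_snd_le_norm_orthCoord {e : Eucl n} (he : ‖e‖ = 1) (z : ℝ × hyperplane e) :
    ‖z.2‖ ≤ ‖orthCoord e z‖ :=
  le_of_sq_le_sq (by rw [norm_sq_orthCoord he]; nlinarith [sq_nonneg z.1]) (norm_nonneg _)

lemma injective_orthCoord {e : Eucl n} (he : ‖e‖ = 1) : Function.Injective (orthCoord e) := by
  intro z w h
  have h' : orthCoord e (z - w) = 0 := by
    have : orthCoord e (z - w) = orthCoord e z - orthCoord e w := by
      simp only [orthCoord, Prod.fst_sub, Prod.snd_sub, sub_smul, Submodule.coe_sub]; abel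
    rw [this, h, sub_self]
  have h1 := abs_fst_le_norm_orthCoord he (z - w)
  have h2 := norm_snd_le_norm_orthCoord he (z - w)
  rw [h', norm_zero] at h1 h2
  refine Prod.ext ?_ ?_
  · exact sub_eq_zero.1 (abs_nonpos_iff.1 h1)
  · exact sub_eq_zero.1 (norm_le_zero_iff.1 h2)

lemma measurableEmbedding_orthCoord {e : Eucl n} (he : ‖e‖ = 1) :
    MeasurableEmbedding (orthCoord e) :=
  (continuous_orthCoord e).measurableEmbedding (injective_orthCoord he)

lemma measurePreserving_orthCoord {e : Eucl n} (he : ‖e‖ = 1) :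
    MeasurePreserving (orthCoord e) (volume.prod volume) volume := by
  have h1 := (LinearIsometryEquiv.toSpanUnitSingleton (𝕜 := ℝ) e he).measurePreserving
  have h2 := h1.prod (MeasurePreserving.id (volume : Measure (hyperplane e)))
  have h3 := WithLp.volume_preserving_toLp (Submodule.span ℝ {e}) (hyperplane e)
  have h4 := ((Submodule.span ℝ {e}).orthogonalDecomposition).symm.measurePreserving
  have h5 := h4.comp (h3.comp h2)
  convert! h5 using 1

lemma inner_epm (ε : Fin n → ℝ) (e v : Eucl n) : ⟪v, epm ε e⟫ = ∑ i, ε i * e i * v i := by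
  simp [PiLp.inner_apply, epm]

lemma quadSym_orthCoord (ε : Fin n → ℝ) (e : Eucl n) (z : ℝ × hyperplane e) :
    quadSym ε (orthCoord e z)
      = quadSym ε e * z.1 ^ 2 + 2 * ⟪(z.2 : Eucl n), epm ε e⟫ * z.1 + quadSym ε (z.2 : Eucl n) := by
  rw [inner_epm]
  simp only [quadSym, orthCoord, PiLp.add_apply, PiLp.smul_apply, smul_eq_mul, Finset.mul_sum,
    Finset.sum_mul, ← Finset.sum_add_distrib]
  refine Finset.sum_congr rfl fun i _ => ?_
  ring

lemma inner_orthCoord_epm (ε : Fin n → ℝ) (e : Eucl n) (z : ℝ × hyperplane e) :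
    ⟪orthCoord e z, epm ε e⟫ = quadSym ε e * z.1 + ⟪(z.2 : Eucl n), epm ε e⟫ := by
  rw [orthCoord, inner_add_left, real_inner_smul_left, inner_epm ε e e, quadSym, mul_comm]
  congr 2
  refine Finset.sum_congr rfl fun i _ => ?_
  ring

lemma continuous_quadSym (ε : Fin n → ℝ) : Continuous (quadSym ε) := by
  unfold quadSym; fun_prop

lemma norm_cexp_quadSym (ε : Fin n → ℝ) (t : ℝ) (ξ : Eucl n) :
    ‖cexp (-I * t * quadSym ε ξ)‖ = 1 := by
  have : -I * t * quadSym ε ξ = (-t * quadSym ε ξ : ℝ) * I := by push_cast; ring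
  rw [this, norm_exp_ofReal_mul_I]

end Geometry

/-- Local smoothing: if the frequency support of `h` stays away from the zero set of the normal
derivative of the symbol, then the free evolution is square integrable on hyperplanes. -/
lemma lintegral_hyperplane_freeEvo_le {n : ℕ} (ε : Fin n → ℝ) {h : Eucl n → ℂ}
    (hc : Continuous h) (hs : HasCompactSupport h) {δ : ℝ} (hδ : 0 < δ) {e : Eucl n} (he : ‖e‖ = 1)
    (hsupp : ∀ ξ, h ξ ≠ 0 → δ ≤ |2 * ⟪ξ, epm ε e⟫|) (r : ℝ) :
    ∫⁻ tv : ℝ × hyperplane e, ‖freeEvo ε h (tv.1, r • e + (tv.2 : Eucl n))‖ₑ ^ 2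
      ≤ ENNReal.ofReal (4 * Real.pi / δ) * ∫⁻ ξ, ‖h ξ‖ₑ ^ 2 := by
  have hqc := continuous_quadSym ε
  have hoc := continuous_orthCoord e
  obtain ⟨R, hR⟩ := hs.isCompact.isBounded.exists_norm_le
  have hR0 : ∀ z : ℝ × hyperplane e, R < |z.1| ∨ R < ‖z.2‖ → h (orthCoord e z) = 0 := by
    intro z hz
    by_contra hne
    have := hR _ (subset_tsupport _ hne)
    rcases hz with hz | hz
    · linarith [abs_fst_le_norm_orthCoord he z]
    · linarith [norm_snd_le_norm_orthCoord he z]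
  set F : (ℝ × hyperplane e) → ℝ → ℂ := fun tη ρ =>
    cexp (-I * tη.1 * quadSym ε (orthCoord e (ρ, tη.2)))
      * (cexp (2 * Real.pi * r * ρ * I) * h (orthCoord e (ρ, tη.2))) with hF
  have hFc : Continuous F.uncurry := by
    simp only [hF, Function.uncurry_def]; fun_prop
  set A : (ℝ × hyperplane e) → ℂ := fun tη => ∫ ρ, F tη ρ with hA
  have hA' : ∀ tη, A tη = ∫ ρ in Set.Icc (-R) R, F tη ρ := fun tη => by
    rw [setIntegral_eq_integral_of_forall_compl_eq_zero]
    intro ρ hρ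
    have : R < |ρ| := by
      by_contra hle
      exact hρ (abs_le.1 (not_lt.1 hle))
    simp only [hF, hR0 (ρ, tη.2) (Or.inl this), mul_zero]
  have hAc : Continuous A := by
    rw [show A = fun tη => ∫ ρ in Set.Icc (-R) R, F tη ρ from funext hA']
    exact continuous_parametric_integral_of_continuous hFc isCompact_Icc
  have hAs : ∀ t, HasCompactSupport fun η => A (t, η) := fun t => by
    refine HasCompactSupport.intro (isCompact_closedBall (0 : hyperplane e) R) fun η hη => ?_
    have : R < ‖η‖ := by simpa using hη
    simp only [hA, hF, hR0 (_, η) (Or.inr this), mul_zero, integral_zero]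
  have hAct : ∀ t, Continuous fun η => A (t, η) := fun t => by fun_prop
  have hevo : ∀ t (v : hyperplane e), freeEvo ε h (t, r • e + (v : Eucl n))
      = 𝓕⁻ (fun η => A (t, η)) v := fun t v => by
    set k : ℝ × hyperplane e → ℂ := fun z =>
      cexp (↑(2 * Real.pi * ⟪orthCoord e z, orthCoord e (r, v)⟫) * I)
        • (cexp (-I * t * quadSym ε (orthCoord e z)) * h (orthCoord e z)) with hk
    have hkc : Continuous k := by
      simp only [hk]
      fun_prop
    have hks : HasCompactSupport k := by
      refine HasCompactSupport.intro
        ((isCompact_Icc (a := -R) (b := R)).prod (isCompact_closedBall (0 : hyperplane e) R))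
        fun z hz => ?_
      have : R < |z.1| ∨ R < ‖z.2‖ := by
        by_contra hcon
        push Not at hcon
        exact hz ⟨abs_le.1 hcon.1, by simpa using hcon.2⟩
      simp only [hk, hR0 z this, mul_zero, smul_zero]
    have hki : Integrable k (volume.prod volume) := hkc.integrable_of_hasCompactSupport hks
    rw [freeEvo, Real.fourierInv_eq', Real.fourierInv_eq',
      ← (measurePreserving_orthCoord he).integral_comp (measurableEmbedding_orthCoord he)]
    change ∫ z, k z ∂(volume.prod volume) = _
    rw [integral_prod_symm _ hki]
    refine integral_congr_ae (Eventually.of_forall fun η => ?_)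
    simp only [hA, hF, hk, smul_eq_mul]
    rw [← integral_const_mul]
    refine integral_congr_ae (Eventually.of_forall fun ρ => ?_)
    simp only [inner_orthCoord he]
    have : cexp (↑(2 * Real.pi * (ρ * r + ⟪η, v⟫)) * I)
        = cexp (↑(2 * Real.pi * ⟪η, v⟫) * I) * cexp (2 * Real.pi * r * ρ * I) := by
      rw [← Complex.exp_add]; congr 1; push_cast; ring
    rw [this]; ring
  calc ∫⁻ tv : ℝ × hyperplane e, ‖freeEvo ε h (tv.1, r • e + (tv.2 : Eucl n))‖ₑ ^ 2
      ≤ ∫⁻ t : ℝ, ∫⁻ v : hyperplane e, ‖freeEvo ε h (t, r • e + (v : Eucl n))‖ₑ ^ 2 :=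
        lintegral_prod_le _
    _ = ∫⁻ t : ℝ, ∫⁻ η : hyperplane e, ‖A (t, η)‖ₑ ^ 2 := by
        refine lintegral_congr fun t => ?_
        simp_rw [hevo t]
        rw [lintegral_enorm_sq_eq_eLpNorm, lintegral_enorm_sq_eq_eLpNorm,
          eLpNorm_fourierInv_eq ((hAct t).integrable_of_hasCompactSupport (hAs t))
          ((hAct t).memLp_of_hasCompactSupport (hAs t))]
    _ = ∫⁻ η : hyperplane e, ∫⁻ t : ℝ, ‖A (t, η)‖ₑ ^ 2 := by
        refine lintegral_lintegral_swap (Measurable.aemeasurable ?_)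
        exact (hAc.enorm.measurable.pow_const 2)
    _ ≤ ∫⁻ η : hyperplane e, ENNReal.ofReal (4 * Real.pi / δ)
          * ∫⁻ ρ : ℝ, ‖h (orthCoord e (ρ, η))‖ₑ ^ 2 := by
        refine lintegral_mono fun η => ?_
        set f : ℝ → ℂ := fun ρ => cexp (2 * Real.pi * r * ρ * I) * h (orthCoord e (ρ, η)) with hf
        have hfc : Continuous f := by simp only [hf]; fun_prop
        have hfs : HasCompactSupport f := by
          refine HasCompactSupport.intro (isCompact_Icc (a := -R) (b := R)) fun ρ hρ => ?_
          have : R < |ρ| := by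
            by_contra hle
            exact hρ (abs_le.1 (not_lt.1 hle))
          simp only [hf, hR0 (ρ, η) (Or.inl this), mul_zero]
        have hfn : ∀ ρ, ‖f ρ‖ₑ = ‖h (orthCoord e (ρ, η))‖ₑ := fun ρ => by
          rw [← ofReal_norm, ← ofReal_norm, hf]
          have : (2 * Real.pi * r * ρ * I : ℂ) = (2 * Real.pi * r * ρ : ℝ) * I := by push_cast; ring
          simp only
          rw [norm_mul, this, norm_exp_ofReal_mul_I, one_mul]
        simp_rw [← hfn]
        have hf2 : ∫⁻ x, ‖f x‖ₑ ^ 2 < ∞ := by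
          rw [lintegral_enorm_sq_eq_eLpNorm]
          exact ENNReal.pow_lt_top (hfc.memLp_of_hasCompactSupport hfs).eLpNorm_lt_top
        have := lintegral_quadratic_phase_le (quadSym ε e) ⟪(η : Eucl n), epm ε e⟫
          (quadSym ε (η : Eucl n)) hδ (hfc.integrable_of_hasCompactSupport hfs) hf2
          (fun ρ hρ => by
            rw [← inner_orthCoord_epm ε e (ρ, η)]
            exact hsupp _ (right_ne_zero_of_mul hρ))
        refine le_trans (le_of_eq ?_) this
        simp only [hA, hF, quadSym_orthCoord, hf]
    _ = _ := by
        rw [lintegral_const_mul' _ _ ENNReal.ofReal_ne_top]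
        congr 1
        rw [← (measurePreserving_orthCoord he).lintegral_comp_emb
          (measurableEmbedding_orthCoord he), lintegral_prod_symm' _]
        exact ((hc.comp hoc).enorm.measurable.pow_const 2)

section TTStar

variable {Ω Ξ : Type*} [MeasurableSpace Ω] [MeasurableSpace Ξ] {μ : Measure Ω} {ν : Measure Ξ}
  [IsFiniteMeasure μ] [SigmaFinite ν]

/-- The `T T*` argument for an integral operator with kernel `T` dominated by `γ ∈ L²`. -/
lemma enorm_integral_mul_sq_le {T : Ω → Ξ → ℂ} (hT : Measurable T.uncurry) {γ : Ξ → ℝ}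
    (hγ : MemLp γ 2 ν) (hTγ : ∀ r ξ, ‖T r ξ‖ ≤ γ ξ) {w : Ξ → ℂ}
    (hw : MemLp w 2 ν) {g : Ω → ℂ} (hg : Measurable g) {M : ℝ} (hgM : ∀ r, ‖g r‖ ≤ M) :
    ‖∫ r, g r * ∫ ξ, T r ξ * w ξ ∂ν ∂μ‖ₑ ^ 2
      ≤ (∫⁻ ξ, ‖w ξ‖ₑ ^ 2 ∂ν) * ∫⁻ z : Ω × Ω, ‖g z.1‖ₑ * ‖g z.2‖ₑ
          * ‖∫ ξ, T z.1 ξ * starRingEnd ℂ (T z.2 ξ) ∂ν‖ₑ ∂(μ.prod μ) := by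
  set B : Ξ → ℂ := fun ξ => ∫ r, g r * T r ξ ∂μ with hB
  have hγ2 : Integrable (fun ξ => γ ξ ^ 2) ν := hγ.integrable_sq
  have hgT : StronglyMeasurable (fun z : Ξ × Ω => g z.2 * T z.2 z.1) := by
    refine Measurable.stronglyMeasurable ?_
    exact (hg.comp measurable_snd).mul (hT.comp measurable_swap)
  have hBm : StronglyMeasurable B := hgT.integral_prod_right
  have hγw : Integrable (fun ξ => γ ξ * ‖w ξ‖) ν := hγ.integrable_mul hw.norm
  have hswap : ∫ r, g r * ∫ ξ, T r ξ * w ξ ∂ν ∂μ = ∫ ξ, w ξ * B ξ ∂ν := by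
    simp_rw [hB, ← integral_const_mul]
    rw [integral_integral_swap]
    · refine integral_congr_ae (Eventually.of_forall fun ξ => ?_)
      refine integral_congr_ae (Eventually.of_forall fun r => ?_)
      simp only; ring
    · refine ((hγw.const_mul M).comp_snd μ).mono' ?_ (Eventually.of_forall fun z => ?_)
      · refine AEStronglyMeasurable.mul ?_ (AEStronglyMeasurable.mul ?_ ?_)
        · exact (hg.comp measurable_fst).aestronglyMeasurable
        · exact hT.aestronglyMeasurable
        · exact hw.1.comp_snd
      · simp only [Function.uncurry_def, norm_mul]
        have := hgM z.1
        have := hTγ z.1 z.2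
        have := norm_nonneg (g z.1)
        gcongr
        linarith
  have hBsq : ∫⁻ ξ, ‖B ξ‖ₑ ^ 2 ∂ν ≤ ∫⁻ z : Ω × Ω, ‖g z.1‖ₑ * ‖g z.2‖ₑ
          * ‖∫ ξ, T z.1 ξ * starRingEnd ℂ (T z.2 ξ) ∂ν‖ₑ ∂(μ.prod μ) := by
    set k : Ξ → Ω × Ω → ℂ := fun ξ z => (g z.1 * T z.1 ξ) * starRingEnd ℂ (g z.2 * T z.2 ξ) with hk
    have hBB : ∀ ξ, ((‖B ξ‖ ^ 2 : ℝ) : ℂ) = ∫ z, k ξ z ∂(μ.prod μ) := fun ξ => by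
      rw [hk, integral_prod_mul (fun r => g r * T r ξ) (fun r => starRingEnd ℂ (g r * T r ξ)),
        integral_conj, Complex.mul_conj, Complex.normSq_eq_norm_sq]
    have hkm : Measurable k.uncurry := by
      have h1 : Measurable fun z : Ξ × (Ω × Ω) => g z.2.1 * T z.2.1 z.1 :=
        hgT.measurable.comp (measurable_fst.prodMk measurable_snd.fst)
      have h2 : Measurable fun z : Ξ × (Ω × Ω) => g z.2.2 * T z.2.2 z.1 :=
        hgT.measurable.comp (measurable_fst.prodMk measurable_snd.snd)
      exact h1.mul (continuous_conj.measurable.comp h2)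
    have hki : Integrable k.uncurry (ν.prod (μ.prod μ)) := by
      refine ((hγ2.const_mul (M ^ 2)).comp_fst (μ.prod μ)).mono' hkm.aestronglyMeasurable
        (Eventually.of_forall fun z => ?_)
      simp only [hk, Function.uncurry_def, norm_mul, RCLike.norm_conj]
      have h1 := hgM z.2.1
      have h2 := hgM z.2.2
      have h3 := hTγ z.2.1 z.1
      have h4 := hTγ z.2.2 z.1
      have h5 := norm_nonneg (g z.2.1)
      have h6 := norm_nonneg (T z.2.1 z.1)
      calc _ ≤ (M * γ z.1) * (M * γ z.1) := by gcongr <;> nlinarith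
        _ = _ := by ring
    have hBi : Integrable (fun ξ => ‖B ξ‖ ^ 2) ν := by
      have := hki.integral_prod_left
      simp only [Function.uncurry_apply_pair, ← hBB] at this
      simpa using this.norm
    have e1 : ∫⁻ ξ, ‖B ξ‖ₑ ^ 2 ∂ν = ‖∫ ξ, ((‖B ξ‖ ^ 2 : ℝ) : ℂ) ∂ν‖ₑ := by
      rw [integral_complex_ofReal, ← ofReal_norm, Complex.norm_real, Real.norm_eq_abs,
        abs_of_nonneg (integral_nonneg fun _ => by positivity),
        ofReal_integral_eq_lintegral_ofReal hBi (Eventually.of_forall fun _ => by positivity)]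
      refine lintegral_congr fun ξ => ?_
      rw [ENNReal.ofReal_pow (norm_nonneg _), ofReal_norm]
    rw [e1]
    simp_rw [hBB]
    rw [integral_integral_swap hki]
    refine (enorm_integral_le_lintegral_enorm _).trans (lintegral_mono fun z => ?_)
    have : ∀ ξ, k ξ z = (g z.1 * starRingEnd ℂ (g z.2)) * (T z.1 ξ * starRingEnd ℂ (T z.2 ξ)) :=
      fun ξ => by simp only [hk, map_mul]; ring
    simp_rw [this]
    rw [integral_const_mul, enorm_mul, enorm_mul, RCLike.enorm_conj]
  rw [hswap]
  have hCS : ‖∫ ξ, w ξ * B ξ ∂ν‖ₑ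
      ≤ (∫⁻ ξ, ‖w ξ‖ₑ ^ (2 : ℝ) ∂ν) ^ (1 / 2 : ℝ) * (∫⁻ ξ, ‖B ξ‖ₑ ^ (2 : ℝ) ∂ν) ^ (1 / 2 : ℝ) := by
    refine (enorm_integral_le_lintegral_enorm _).trans ?_
    simp_rw [enorm_mul]
    exact ENNReal.lintegral_mul_le_Lp_mul_Lq ν Real.HolderConjugate.two_two hw.1.enorm
      hBm.measurable.enorm.aemeasurable
  calc _ ≤ ((∫⁻ ξ, ‖w ξ‖ₑ ^ (2 : ℝ) ∂ν) ^ (1 / 2 : ℝ)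
        * (∫⁻ ξ, ‖B ξ‖ₑ ^ (2 : ℝ) ∂ν) ^ (1 / 2 : ℝ)) ^ 2 := by gcongr
    _ = (∫⁻ ξ, ‖w ξ‖ₑ ^ 2 ∂ν) * ∫⁻ ξ, ‖B ξ‖ₑ ^ 2 ∂ν := by
      rw [mul_pow, ← ENNReal.rpow_natCast, ← ENNReal.rpow_natCast, ← ENNReal.rpow_mul,
        ← ENNReal.rpow_mul]
      norm_num
    _ ≤ _ := by gcongr

end TTStar

/-- A Young-type inequality for the bilinear form with convolution kernel `k`. -/
lemma lintegral_bilinear_le {p : ℕ} (hp : 2 ≤ p) {N : ℝ → ℝ≥0∞} (hN : Measurable N)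
    {k : ℝ → ℝ≥0∞} (hk : Measurable k) {μ : Measure ℝ} [SFinite μ] (hμ : μ ≤ volume) :
    ∫⁻ z : ℝ × ℝ, N z.1 ^ (p - 1) * N z.2 ^ (p - 1) * k (z.1 - z.2) ∂(μ.prod μ)
      ≤ (∫⁻ r, N r ^ p ∂μ) ^ (2 - 2 / p : ℝ)
        * (2 * ∫⁻ s, k s ^ (p / 2 : ℝ)) ^ (2 / p : ℝ) := by
  have hp2 : (2 : ℝ) ≤ p := by exact_mod_cast hp
  have hp0 : (0 : ℝ) < p := by linarith
  set X := ∫⁻ r, N r ^ p ∂μ with hX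
  set K := ∫⁻ s, k s ^ (p / 2 : ℝ) with hK
  have h2p : (2 / p : ℝ) ≤ 1 := by rw [div_le_one hp0]; exact hp2
  have hhalf : ∀ a : ℝ≥0∞, a ^ (p / 2 : ℝ) * a ^ (p / 2 : ℝ) = a ^ p := fun a => by
    rw [← ENNReal.rpow_add_of_nonneg _ _ (by positivity) (by positivity), add_halves,
      ENNReal.rpow_natCast]
  have hexp : ∀ a b c : ℝ≥0∞, a ^ (p - 1) * b ^ (p - 1) * c
      = (a ^ p * b ^ p) ^ (1 - 2 / p : ℝ)
        * (a ^ (p / 2 : ℝ) * b ^ (p / 2 : ℝ) * c ^ (p / 2 : ℝ)) ^ (2 / p : ℝ) := fun a b c => by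
    have hone : ∀ a : ℝ≥0∞, (a ^ (p / 2 : ℝ)) ^ (2 / p : ℝ) = a := fun a => by
      rw [← ENNReal.rpow_mul]; field_simp; simp
    have htwo : ∀ a : ℝ≥0∞, (a ^ p) ^ (1 - 2 / p : ℝ) = a ^ (p - 2) := fun a => by
      rw [← ENNReal.rpow_natCast, ← ENNReal.rpow_mul, ← ENNReal.rpow_natCast, Nat.cast_sub hp]
      congr 1; field_simp; norm_num
    rw [ENNReal.mul_rpow_of_nonneg _ _ (by linarith), ENNReal.mul_rpow_of_nonneg _ _ (by positivity),
      ENNReal.mul_rpow_of_nonneg _ _ (by positivity), hone, hone, hone, htwo, htwo]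
    have : p - 1 = p - 2 + 1 := by omega
    rw [this, pow_succ, pow_succ]; ring
  simp_rw [hexp]
  have hNp : Measurable fun r => N r ^ p := hN.pow_const p
  refine (ENNReal.lintegral_mul_norm_pow_le (by fun_prop) (by fun_prop) (by linarith)
    (by positivity) (by ring)).trans ?_
  have e1 : ∫⁻ z : ℝ × ℝ, N z.1 ^ p * N z.2 ^ p ∂(μ.prod μ) = X * X :=
    lintegral_prod_mul hNp.aemeasurable hNp.aemeasurable
  have hkm : Measurable fun s => k s ^ (p / 2 : ℝ) := hk.pow_const _
  have e2 : ∫⁻ z : ℝ × ℝ, N z.1 ^ (p / 2 : ℝ) * N z.2 ^ (p / 2 : ℝ) * k (z.1 - z.2) ^ (p / 2 : ℝ)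
      ∂(μ.prod μ) ≤ X * (2 * K) := by
    calc _ ≤ ∫⁻ z : ℝ × ℝ, (N z.1 ^ p * k (z.1 - z.2) ^ (p / 2 : ℝ)
          + N z.2 ^ p * k (z.1 - z.2) ^ (p / 2 : ℝ)) ∂(μ.prod μ) := by
          refine lintegral_mono fun z => ?_
          simp only
          rw [← add_mul]
          gcongr
          rcases le_total (N z.1) (N z.2) with h | h
          · refine le_trans ?_ le_add_self
            rw [← hhalf]; gcongr
          · refine le_trans ?_ le_self_add
            rw [← hhalf (N z.1)]; gcongr
      _ = (∫⁻ r, N r ^ p * ∫⁻ s, k (r - s) ^ (p / 2 : ℝ) ∂μ ∂μ)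
          + ∫⁻ s, N s ^ p * ∫⁻ r, k (r - s) ^ (p / 2 : ℝ) ∂μ ∂μ := by
          rw [lintegral_add_left (by fun_prop), lintegral_prod _ (by fun_prop),
            lintegral_prod_symm _ (by fun_prop)]
          congr 1
          · refine lintegral_congr fun r => ?_
            exact lintegral_const_mul (N r ^ p) (f := fun s => k (r - s) ^ (p / 2 : ℝ)) (by fun_prop)
          · refine lintegral_congr fun r => ?_
            exact lintegral_const_mul (N r ^ p) (f := fun s => k (s - r) ^ (p / 2 : ℝ)) (by fun_prop)
      _ ≤ (∫⁻ r, N r ^ p * K ∂μ) + ∫⁻ s, N s ^ p * K ∂μ := by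
          gcongr with r s
          · refine (lintegral_mono' hμ le_rfl).trans (le_of_eq ?_)
            exact lintegral_sub_left_eq_self (fun s => k s ^ (p / 2 : ℝ)) r
          · refine (lintegral_mono' hμ le_rfl).trans (le_of_eq ?_)
            exact lintegral_sub_right_eq_self (fun s => k s ^ (p / 2 : ℝ)) s
      _ = _ := by rw [lintegral_mul_const _ hNp]; ring
  rw [e1]
  calc _ ≤ (X * X) ^ (1 - 2 / p : ℝ) * (X * (2 * K)) ^ (2 / p : ℝ) := by gcongr
    _ = _ := by
      rw [ENNReal.mul_rpow_of_nonneg X (2 * K) (by positivity), ← mul_assoc, ← sq,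
        ← ENNReal.rpow_natCast X, ← ENNReal.rpow_mul,
        ← ENNReal.rpow_add_of_nonneg _ _ (by push_cast; nlinarith) (by positivity)]
      congr 2; push_cast; ring

lemma norm_integral_gaussian_quadSym {n : ℕ} {ε : Fin n → ℝ} (hε : ∀ i, ε i ^ 2 = 1)
    {β : ℝ} (hβ : 0 < β) (τ : ℝ) (y : Eucl n) :
    ‖∫ ξ : Eucl n, cexp (-(β * ‖ξ‖ ^ 2 + I * τ * quadSym ε ξ) + 2 * Real.pi * I * ⟪ξ, y⟫)‖
      = (Real.pi ^ 2 / (β ^ 2 + τ ^ 2)) ^ (n / 4 : ℝ)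
        * Real.exp (-(Real.pi ^ 2 * ‖y‖ ^ 2 * β / (β ^ 2 + τ ^ 2))) := by
  set b : Fin n → ℂ := fun i => β + I * τ * ε i with hb
  set c : Fin n → ℂ := fun i => 2 * Real.pi * I * y i with hc
  have hbre : ∀ i, (b i).re = β := fun i => by simp [hb]
  have hbim : ∀ i, (b i).im = τ * ε i := fun i => by simp [hb]
  have hbn : ∀ i, Complex.normSq (b i) = β ^ 2 + τ ^ 2 := fun i => by
    rw [Complex.normSq_apply, hbre, hbim]; linear_combination τ ^ 2 * hε i
  have hs : 0 < β ^ 2 + τ ^ 2 := by positivity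
  have e1 : ∫ ξ : Eucl n, cexp (-(β * ‖ξ‖ ^ 2 + I * τ * quadSym ε ξ) + 2 * Real.pi * I * ⟪ξ, y⟫)
      = ∏ i, (Real.pi / b i) ^ (1 / 2 : ℂ) * cexp (c i ^ 2 / (4 * b i)) := by
    rw [← GaussianFourier.integral_cexp_neg_sum_mul_add (fun i => by rw [hbre]; exact hβ) c,
      ← (PiLp.volume_preserving_toLp (Fin n)).integral_comp
        (MeasurableEquiv.toLp 2 (Fin n → ℝ)).measurableEmbedding]
    refine integral_congr_ae (Eventually.of_forall fun v => ?_)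
    simp only [quadSym, PiLp.inner_apply, ← ofReal_pow, EuclideanSpace.norm_sq_eq, hb, hc]
    push_cast
    congr 2
    · rw [Finset.mul_sum, Finset.mul_sum, ← Finset.sum_add_distrib]
      congr 1
      refine Finset.sum_congr rfl fun i _ => ?_
      simp only [Real.norm_eq_abs, ← ofReal_pow, sq_abs]
      push_cast; ring
    · rw [Finset.mul_sum]
      refine Finset.sum_congr rfl fun i _ => ?_
      simp; ring
  have e2 : ∀ i, ‖(Real.pi / b i : ℂ) ^ (1 / 2 : ℂ) * cexp (c i ^ 2 / (4 * b i))‖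
      = (Real.pi ^ 2 / (β ^ 2 + τ ^ 2)) ^ (1 / 4 : ℝ)
        * Real.exp (-(Real.pi ^ 2 * y i ^ 2 * β / (β ^ 2 + τ ^ 2))) := fun i => by
    have hb0 : b i ≠ 0 := fun h => by
      have := hbre i; rw [h] at this; simp at this; linarith
    have h1 : (1 / 2 : ℂ) = ((1 / 2 : ℝ) : ℂ) := by push_cast; rfl
    rw [norm_mul, h1, Complex.norm_cpow_real, Complex.norm_exp]
    congr 1
    · rw [norm_div, Complex.norm_real, Real.norm_of_nonneg Real.pi_pos.le, ← hbn i,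
        Complex.normSq_eq_norm_sq, ← div_pow, ← Real.rpow_natCast, ← Real.rpow_mul (by positivity)]
      norm_num
    · have : c i ^ 2 / (4 * b i) = ((-(Real.pi ^ 2 * y i ^ 2) : ℝ) : ℂ) * (b i)⁻¹ := by
        simp only [hc, mul_pow, I_sq]
        field_simp
        push_cast; ring
      rw [this, Complex.re_ofReal_mul, Complex.inv_re, hbre, hbn]
      congr 1; ring
  rw [e1, norm_prod]
  simp_rw [e2]
  rw [Finset.prod_mul_distrib, Finset.prod_const, Finset.card_univ, Fintype.card_fin,
    ← Real.rpow_natCast, ← Real.rpow_mul (by positivity), ← Real.exp_sum,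
    EuclideanSpace.real_norm_sq_eq, Finset.mul_sum, Finset.sum_mul, Finset.sum_div,
    Finset.sum_neg_distrib]
  congr 2; ring

/-- Majorant of the kernel of `T T*` for the maximal function at frequency `L`. -/
def kerBound (n : ℕ) (L ρ : ℝ) : ℝ :=
  (n * Real.pi ^ 2 * L ^ 4 / (1 + (L * ρ) ^ 2)) ^ (n / 4 : ℝ)

lemma kerBound_nonneg (n : ℕ) (L ρ : ℝ) : 0 ≤ kerBound n L ρ := by
  unfold kerBound; positivity

lemma continuous_kerBound (n : ℕ) (L : ℝ) : Continuous (kerBound n L) := by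
  unfold kerBound
  refine Continuous.rpow_const (Continuous.div (by fun_prop) (by fun_prop) fun x => by positivity)
    fun x => Or.inr (by positivity)

lemma norm_integral_gaussian_quadSym_le {n : ℕ} (hn : 0 < n) {ε : Fin n → ℝ}
    (hε : ∀ i, ε i ^ 2 = 1) {L : ℝ} (hL : 0 < L) (τ : ℝ) {y : Eucl n} {ρ : ℝ} (hρ : |ρ| ≤ ‖y‖) :
    ‖∫ ξ : Eucl n, cexp (-(((2 / L ^ 2 : ℝ) : ℂ) * ‖ξ‖ ^ 2 + I * τ * quadSym ε ξ)
        + 2 * Real.pi * I * ⟪ξ, y⟫)‖ ≤ kerBound n L ρ := by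
  have hβ : 0 < 2 / L ^ 2 := by positivity
  rw [norm_integral_gaussian_quadSym hε hβ]
  set β := 2 / L ^ 2 with hβd
  have hn' : (0 : ℝ) < n := by exact_mod_cast hn
  have hs : 0 < β ^ 2 + τ ^ 2 := by positivity
  set w := ρ ^ 2 * β / (β ^ 2 + τ ^ 2) with hw
  have hw0 : 0 ≤ w := by positivity
  have hρ2 : ρ ^ 2 ≤ ‖y‖ ^ 2 := by rw [← sq_abs]; gcongr
  have h1 : 1 + w ≤ n * Real.exp (w / n) := by
    have h2 := Real.add_one_le_exp (w / n)
    have h3 : (1 : ℝ) ≤ n := by exact_mod_cast hn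
    calc 1 + w ≤ n + w := by linarith
      _ = n * (w / n + 1) := by field_simp; ring
      _ ≤ _ := by gcongr
  have h2 : (1 + (L * ρ) ^ 2) / L ^ 4 ≤ (1 + w) * (β ^ 2 + τ ^ 2) := by
    have : (1 + w) * (β ^ 2 + τ ^ 2) = β ^ 2 + τ ^ 2 + ρ ^ 2 * β := by rw [hw]; field_simp
    rw [this]
    have e : (1 + (L * ρ) ^ 2) / L ^ 4 = β ^ 2 / 4 + ρ ^ 2 * β / 2 := by rw [hβd]; field_simp; ring
    rw [e]
    have : 0 ≤ ρ ^ 2 * β := by positivity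
    nlinarith [sq_nonneg τ, sq_nonneg β]
  have h3 : Real.pi ^ 2 / (β ^ 2 + τ ^ 2)
      ≤ n * Real.pi ^ 2 * L ^ 4 / (1 + (L * ρ) ^ 2) * Real.exp (w / n) := by
    have h4 : (1 + (L * ρ) ^ 2) / L ^ 4 ≤ n * Real.exp (w / n) * (β ^ 2 + τ ^ 2) :=
      h2.trans (by gcongr)
    rw [div_le_iff₀ (by positivity)] at h4
    rw [div_le_iff₀ hs, div_mul_eq_mul_div, div_mul_eq_mul_div, le_div_iff₀ (by positivity)]
    calc _ ≤ Real.pi ^ 2 * (n * Real.exp (w / n) * (β ^ 2 + τ ^ 2) * L ^ 4) := by gcongr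
      _ = _ := by ring
  have h5 : Real.exp (-(Real.pi ^ 2 * ‖y‖ ^ 2 * β / (β ^ 2 + τ ^ 2))) ≤ Real.exp (-(w / 4)) := by
    rw [Real.exp_le_exp, neg_le_neg_iff]
    have : Real.pi ^ 2 * ‖y‖ ^ 2 * β / (β ^ 2 + τ ^ 2)
        = Real.pi ^ 2 * (‖y‖ ^ 2 * β / (β ^ 2 + τ ^ 2)) := by ring
    rw [this]
    have h6 : w ≤ ‖y‖ ^ 2 * β / (β ^ 2 + τ ^ 2) := by rw [hw]; gcongr
    have h7 : (1 : ℝ) ≤ Real.pi ^ 2 := by nlinarith [Real.pi_gt_three]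
    nlinarith
  calc _ ≤ (n * Real.pi ^ 2 * L ^ 4 / (1 + (L * ρ) ^ 2) * Real.exp (w / n)) ^ (n / 4 : ℝ)
        * Real.exp (-(w / 4)) := by gcongr
    _ = kerBound n L ρ := by
      rw [Real.mul_rpow (by positivity) (by positivity), ← Real.exp_mul, mul_assoc, ← Real.exp_add,
        kerBound]
      have : w / n * (n / 4) + -(w / 4) = 0 := by field_simp; ring
      rw [this, Real.exp_zero, mul_one]

/-- The scaling of the `L^{p/2}` norm of the kernel bound. -/
lemma exists_lintegral_kerBound_le (n : ℕ) {p : ℕ} (hnp : 4 < n * p) :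
    ∃ C : ℝ, 0 < C ∧ ∀ L : ℝ, 0 < L →
      ∫⁻ ρ, ENNReal.ofReal (kerBound n L ρ) ^ (p / 2 : ℝ)
        ≤ ENNReal.ofReal (C * L ^ (n * p / 2 - 1 : ℝ)) := by
  have hnp' : (4 : ℝ) < n * p := by exact_mod_cast hnp
  have hint : Integrable (fun u : ℝ => (1 + ‖u‖ ^ 2) ^ (-(n * p / 4 : ℝ) / 2)) := by
    refine integrable_rpow_neg_one_add_norm_sq ?_
    rw [Module.finrank_self]; push_cast; linarith
  set J := ∫ u : ℝ, (1 + ‖u‖ ^ 2) ^ (-(n * p / 4 : ℝ) / 2) with hJ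
  have hJ0 : 0 ≤ J := integral_nonneg fun u => by positivity
  refine ⟨(n * Real.pi ^ 2) ^ (n * p / 8 : ℝ) * J + 1, by positivity, fun L hL => ?_⟩
  have e1 : ∀ ρ, ENNReal.ofReal (kerBound n L ρ) ^ (p / 2 : ℝ)
      = ENNReal.ofReal ((n * Real.pi ^ 2 * L ^ 4) ^ (n * p / 8 : ℝ))
        * ENNReal.ofReal ((1 + ‖L * ρ‖ ^ 2) ^ (-(n * p / 4 : ℝ) / 2)) := fun ρ => by
    rw [ENNReal.ofReal_rpow_of_nonneg (kerBound_nonneg _ _ _) (by positivity),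
      ← ENNReal.ofReal_mul (by positivity), kerBound, ← Real.rpow_mul (by positivity),
      Real.div_rpow (by positivity) (by positivity), Real.norm_eq_abs, sq_abs, div_eq_mul_inv,
      ← Real.rpow_neg (by positivity)]
    congr 3 <;> ring
  simp_rw [e1]
  rw [lintegral_const_mul' _ _ ENNReal.ofReal_ne_top,
    lintegral_comp_mul_left_real hL.ne'
      (fun u => ENNReal.ofReal ((1 + ‖u‖ ^ 2) ^ (-(n * p / 4 : ℝ) / 2))),
    ← ofReal_integral_eq_lintegral_ofReal hint (Eventually.of_forall fun u => by positivity),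
    ← ENNReal.ofReal_mul (by positivity), ← ENNReal.ofReal_mul (by positivity), ← hJ]
  refine ENNReal.ofReal_le_ofReal ?_
  have e2 : (n * Real.pi ^ 2 * L ^ 4) ^ (n * p / 8 : ℝ)
      = (n * Real.pi ^ 2) ^ (n * p / 8 : ℝ) * L ^ (n * p / 2 : ℝ) := by
    rw [Real.mul_rpow (by positivity) (by positivity), ← Real.rpow_natCast L 4,
      ← Real.rpow_mul hL.le]
    congr 2; push_cast; ring
  rw [e2, abs_of_pos (by positivity), Real.rpow_sub_one hL.ne']
  have : 0 < L ^ (n * p / 2 : ℝ) / L := by positivity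
  calc _ = ((n * Real.pi ^ 2) ^ (n * p / 8 : ℝ) * J) * (L ^ (n * p / 2 : ℝ) / L) := by ring
    _ ≤ _ := by gcongr; linarith

section Maximal

variable {n : ℕ} {ε : Fin n → ℝ} {h : Eucl n → ℂ}

lemma freeEvo_eq_integral (ε : Fin n → ℝ) (h : Eucl n → ℂ) (z : ℝ × Eucl n) :
    freeEvo ε h z = ∫ ξ, cexp ((2 * Real.pi * ⟪ξ, z.2⟫ : ℝ) * I)
      * (cexp (-I * z.1 * quadSym ε ξ) * h ξ) := by
  rw [freeEvo, Real.fourierInv_eq']; rfl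

lemma norm_freeEvo_integrand (ε : Fin n → ℝ) (h : Eucl n → ℂ) (z : ℝ × Eucl n) (ξ : Eucl n) :
    ‖cexp ((2 * Real.pi * ⟪ξ, z.2⟫ : ℝ) * I) * (cexp (-I * z.1 * quadSym ε ξ) * h ξ)‖ = ‖h ξ‖ := by
  rw [norm_mul, norm_mul, norm_cexp_quadSym, norm_exp_ofReal_mul_I, one_mul, one_mul]

lemma norm_freeEvo_le (ε : Fin n → ℝ) (h : Eucl n → ℂ) (z : ℝ × Eucl n) :
    ‖freeEvo ε h z‖ ≤ ∫ ξ, ‖h ξ‖ := by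
  rw [freeEvo_eq_integral]
  refine (norm_integral_le_integral_norm _).trans (le_of_eq ?_)
  simp_rw [norm_freeEvo_integrand]

lemma continuous_freeEvo (ε : Fin n → ℝ) (hc : Continuous h) (hi : Integrable h) :
    Continuous (freeEvo ε h) := by
  have hq := continuous_quadSym ε
  have : freeEvo ε h = fun z => ∫ ξ, cexp ((2 * Real.pi * ⟪ξ, z.2⟫ : ℝ) * I)
      * (cexp (-I * z.1 * quadSym ε ξ) * h ξ) := funext fun z => freeEvo_eq_integral ε h z
  rw [this]
  refine continuous_of_dominated (bound := fun ξ => ‖h ξ‖) (fun z => ?_) (fun z => ?_) hi.norm ?_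
  · exact Continuous.aestronglyMeasurable (by fun_prop)
  · exact Eventually.of_forall fun ξ => (norm_freeEvo_integrand ε h z ξ).le
  · exact Eventually.of_forall fun ξ => by fun_prop

set_option maxHeartbeats 400000 in
/-- The linearised maximal estimate along measurable selections of points. -/
lemma lintegral_freeEvo_selection_le (hn : 0 < n) (hε : ∀ i, ε i ^ 2 = 1) {p : ℕ} (hp : 2 ≤ p)
    {L : ℝ} (hL : 0 < L) (hc : Continuous h) (hi : Integrable h) (h2 : MemLp h 2)
    (hsupp : ∀ ξ, h ξ ≠ 0 → ‖ξ‖ ≤ 2 * L) {z : ℝ → ℝ × Eucl n} (hz : Measurable z)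
    (hzd : ∀ r s, |r - s| ≤ ‖(z r).2 - (z s).2‖) :
    ∫⁻ r, ‖freeEvo ε h (z r)‖ₑ ^ p
      ≤ (ENNReal.ofReal (Real.exp 4) ^ 2 * ∫⁻ ξ, ‖h ξ‖ₑ ^ 2) ^ (p / 2 : ℝ)
        * (2 * ∫⁻ ρ, ENNReal.ofReal (kerBound n L ρ) ^ (p / 2 : ℝ)) := by
  have hp0 : (0 : ℝ) < p := by exact_mod_cast (by omega : 0 < p)
  have hp2 : (2 : ℝ) ≤ p := by exact_mod_cast hp
  have hq := continuous_quadSym ε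
  set γ : Eucl n → ℝ := fun ξ => Real.exp (-(1 / L ^ 2) * ‖ξ‖ ^ 2) with hγ
  set w : Eucl n → ℂ := fun ξ => (Real.exp (1 / L ^ 2 * ‖ξ‖ ^ 2) : ℝ) * h ξ with hw
  have hγw : ∀ ξ, (γ ξ : ℂ) * w ξ = h ξ := fun ξ => by
    simp only [hγ, hw, ← mul_assoc, ← ofReal_mul, ← Real.exp_add]; simp
  have hwle : ∀ ξ, ‖w ξ‖ ≤ Real.exp 4 * ‖h ξ‖ := fun ξ => by
    by_cases h0 : h ξ = 0
    · simp [hw, h0]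
    have h1 := hsupp ξ h0
    rw [hw, norm_mul, Complex.norm_real, Real.norm_of_nonneg (Real.exp_pos _).le]
    gcongr
    rw [one_div_mul_eq_div, div_le_iff₀ (by positivity)]
    nlinarith [norm_nonneg ξ]
  have hwc : Continuous w := by rw [hw]; fun_prop
  have hw2 : MemLp w 2 := by
    refine MemLp.of_le_mul h2 hwc.aestronglyMeasurable (Eventually.of_forall hwle)
  have hγ2 : MemLp γ 2 := by
    have hγc : Continuous γ := by rw [hγ]; fun_prop
    rw [memLp_two_iff_integrable_sq hγc.aestronglyMeasurable]
    have := (GaussianFourier.integrable_cexp_neg_mul_sq_norm_add (V := Eucl n)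
      (b := ((2 / L ^ 2 : ℝ) : ℂ)) (by rw [ofReal_re]; positivity) 0 0).norm
    refine this.congr (Eventually.of_forall fun ξ => ?_)
    simp only [hγ]
    rw [Complex.norm_exp, ← Real.exp_nat_mul]
    congr 1
    have : -((2 / L ^ 2 : ℝ) : ℂ) * (‖ξ‖ : ℂ) ^ 2 + 0 * (⟪(0 : Eucl n), ξ⟫ : ℂ)
      = ((-(2 / L ^ 2) * ‖ξ‖ ^ 2 : ℝ) : ℂ) := by push_cast; ring
    rw [this, ofReal_re]; push_cast; ring
  set T : ℝ → Eucl n → ℂ := fun r ξ =>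
    cexp ((2 * Real.pi * ⟪ξ, (z r).2⟫ : ℝ) * I) * (cexp (-I * (z r).1 * quadSym ε ξ) * γ ξ) with hT
  have hTm : Measurable T.uncurry := by
    set G : (ℝ × Eucl n) × Eucl n → ℂ := fun y =>
      cexp ((2 * Real.pi * ⟪y.2, y.1.2⟫ : ℝ) * I) * (cexp (-I * y.1.1 * quadSym ε y.2) * γ y.2)
      with hG
    have h1 : Continuous G := by rw [hG, hγ]; fun_prop
    have h3 : Measurable fun y : ℝ × Eucl n => (z y.1, y.2) :=
      (hz.comp measurable_fst).prodMk measurable_snd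
    have h4 : T.uncurry = fun y => G (z y.1, y.2) := by
      funext y; simp only [hG, hT, Function.uncurry_def]
    rw [h4]
    exact h1.measurable.comp h3
  have hTγ : ∀ r ξ, ‖T r ξ‖ ≤ γ ξ := fun r ξ => by
    have h1 : 0 ≤ γ ξ := (Real.exp_pos _).le
    simp only [hT]
    rw [norm_mul, norm_mul, norm_cexp_quadSym, norm_exp_ofReal_mul_I, one_mul, one_mul,
      Complex.norm_real, Real.norm_of_nonneg h1]
  set F : ℝ → ℂ := fun r => freeEvo ε h (z r) with hF
  have hFm : Measurable F := (continuous_freeEvo ε hc hi).measurable.comp hz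
  have hFT : ∀ r, ∫ ξ, T r ξ * w ξ = F r := fun r => by
    simp only [hF]
    rw [freeEvo_eq_integral]
    refine integral_congr_ae (Eventually.of_forall fun ξ => ?_)
    simp only [hT, ← hγw]; ring
  have hker : ∀ r s, ‖∫ ξ, T r ξ * starRingEnd ℂ (T s ξ)‖ₑ
      ≤ ENNReal.ofReal (kerBound n L (r - s)) := fun r s => by
    rw [← ofReal_norm]
    refine ENNReal.ofReal_le_ofReal (le_of_eq_of_le ?_
      (norm_integral_gaussian_quadSym_le hn hε hL ((z r).1 - (z s).1) (hzd r s)))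
    congr 1
    refine integral_congr_ae (Eventually.of_forall fun ξ => ?_)
    simp only [hT, hγ, ← Complex.exp_conj, ofReal_exp, ← Complex.exp_add, inner_sub_right]
    congr 1
    push_cast
    simp only [map_add, map_mul, map_neg, map_pow, map_div₀, map_ofNat, map_one, conj_ofReal, conj_I]
    ring
  set M := ∫ ξ, ‖h ξ‖ with hM
  have hFM : ∀ r, ‖F r‖ ≤ M := fun r => norm_freeEvo_le ε h (z r)
  have hM0 : 0 ≤ M := (norm_nonneg _).trans (hFM 0)
  set g : ℝ → ℂ := fun r => (‖F r‖ : ℂ) ^ (p - 2) * starRingEnd ℂ (F r) with hg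
  have hgn : ∀ r, ‖g r‖ = ‖F r‖ ^ (p - 1) := fun r => by
    rw [hg, norm_mul, norm_pow, RCLike.norm_conj, Complex.norm_real, norm_norm, ← pow_succ]
    congr 1; omega
  have hgm : Measurable g := by
    have := hFm.norm
    have h3 : Measurable fun r => starRingEnd ℂ (F r) := continuous_conj.measurable.comp hFm
    exact ((measurable_ofReal.comp this).pow_const _).mul h3
  have hgF : ∀ r, g r * F r = ((‖F r‖ ^ p : ℝ) : ℂ) := fun r => by
    rw [hg, mul_assoc, mul_comm (starRingEnd ℂ (F r)), Complex.mul_conj, Complex.normSq_eq_norm_sq]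
    push_cast
    rw [← pow_add]; congr 1; omega
  set W := ENNReal.ofReal (Real.exp 4) ^ 2 * ∫⁻ ξ, ‖h ξ‖ₑ ^ 2 with hW
  set K := ∫⁻ ρ, ENNReal.ofReal (kerBound n L ρ) ^ (p / 2 : ℝ) with hK
  have hWw : ∫⁻ ξ, ‖w ξ‖ₑ ^ 2 ≤ W := by
    rw [hW, ← lintegral_const_mul' _ _ (by finiteness)]
    refine lintegral_mono fun ξ => ?_
    rw [← mul_pow]
    gcongr
    rw [← ofReal_norm, ← ofReal_norm, ← ENNReal.ofReal_mul (by positivity)]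
    exact ENNReal.ofReal_le_ofReal (hwle ξ)
  have key : ∀ R : ℕ, ∫⁻ r in Set.Icc (-(R : ℝ)) R, ‖F r‖ₑ ^ p ≤ W ^ (p / 2 : ℝ) * (2 * K) := by
    intro R
    set μ : Measure ℝ := volume.restrict (Set.Icc (-(R : ℝ)) R) with hμ
    have : IsFiniteMeasure μ := ⟨by rw [hμ, Measure.restrict_apply_univ]; simp⟩
    set X := ∫⁻ r, ‖F r‖ₑ ^ p ∂μ with hX
    have hXi : Integrable (fun r => ‖F r‖ ^ p) μ := by
      refine Integrable.of_bound (C := M ^ p) (hFm.norm.pow_const p).aestronglyMeasurable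
        (Eventually.of_forall fun r => ?_)
      rw [Real.norm_of_nonneg (by positivity)]
      exact pow_le_pow_left₀ (norm_nonneg _) (hFM r) p
    have hXe : X = ‖∫ r, g r * ∫ ξ, T r ξ * w ξ ∂volume ∂μ‖ₑ := by
      simp_rw [hFT, hgF]
      rw [integral_complex_ofReal, ← ofReal_norm, Complex.norm_real,
        Real.norm_of_nonneg (integral_nonneg fun _ => by positivity),
        ofReal_integral_eq_lintegral_ofReal hXi (Eventually.of_forall fun _ => by positivity)]
      refine lintegral_congr fun r => ?_
      rw [ENNReal.ofReal_pow (norm_nonneg _), ofReal_norm]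
    have hXtop : X ≠ ∞ := by rw [hXe]; exact enorm_ne_top
    have hmain : X ^ 2 ≤ W * (X ^ (2 - 2 / p : ℝ) * (2 * K) ^ (2 / p : ℝ)) := by
      have h1 := enorm_integral_mul_sq_le (μ := μ) (ν := volume) hTm hγ2 hTγ hw2 hgm
        (M := M ^ (p - 1)) fun r => by
          rw [hgn]; exact pow_le_pow_left₀ (norm_nonneg _) (hFM r) _
      rw [← hXe] at h1
      refine h1.trans (mul_le_mul' hWw ?_)
      refine le_trans (lintegral_mono fun y => ?_) (lintegral_bilinear_le hp hFm.enorm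
        (k := fun ρ => ENNReal.ofReal (kerBound n L ρ))
        (continuous_kerBound n L).measurable.ennreal_ofReal (μ := μ) Measure.restrict_le_self)
      have hgN : ∀ r, ‖g r‖ₑ = ‖F r‖ₑ ^ (p - 1) := fun r => by
        rw [← ofReal_norm, hgn, ENNReal.ofReal_pow (norm_nonneg _), ofReal_norm]
      rw [hgN, hgN]
      gcongr
      exact hker _ _
    rcases eq_or_ne X 0 with h0 | h0
    · rw [h0]; exact zero_le
    have h3 : X ^ (2 / p : ℝ) ≤ W * (2 * K) ^ (2 / p : ℝ) := by
      have e1 : X ^ 2 = X ^ (2 - 2 / p : ℝ) * X ^ (2 / p : ℝ) := by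
        rw [← ENNReal.rpow_add _ _ h0 hXtop, ← ENNReal.rpow_natCast]; congr 1; push_cast; ring
      rw [e1, mul_left_comm] at hmain
      refine (ENNReal.mul_le_mul_iff_right ?_ ?_).1 hmain
      · simp [h0, hXtop]
      · simp [h0, hXtop]
    calc X = (X ^ (2 / p : ℝ)) ^ (p / 2 : ℝ) := by
          rw [← ENNReal.rpow_mul]; field_simp; simp
      _ ≤ (W * (2 * K) ^ (2 / p : ℝ)) ^ (p / 2 : ℝ) := by gcongr
      _ = W ^ (p / 2 : ℝ) * (2 * K) := by
          rw [ENNReal.mul_rpow_of_nonneg _ _ (by positivity), ← ENNReal.rpow_mul (2 * K)]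
          congr 1; field_simp; simp
  have hcov : AECover (volume : Measure ℝ) atTop fun R : ℕ => Set.Icc (-(R : ℝ)) R :=
    aecover_Icc (tendsto_neg_atTop_atBot.comp tendsto_natCast_atTop_atTop)
      tendsto_natCast_atTop_atTop
  exact le_of_tendsto' (hcov.lintegral_tendsto_of_nat (hFm.enorm.pow_const p).aemeasurable) key

/-- The maximal function estimate in the direction `e`. -/
lemma lintegral_iSup_freeEvo_le (hn : 0 < n) (hε : ∀ i, ε i ^ 2 = 1) {p : ℕ} (hp : 2 ≤ p)
    {L : ℝ} (hL : 0 < L) (hc : Continuous h) (hi : Integrable h) (h2 : MemLp h 2)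
    (hsupp : ∀ ξ, h ξ ≠ 0 → ‖ξ‖ ≤ 2 * L) {e : Eucl n} (he : ‖e‖ = 1) :
    ∫⁻ r, innerQ ∞ e (freeEvo ε h) r ^ p
      ≤ 2 ^ p * ((ENNReal.ofReal (Real.exp 4) ^ 2 * ∫⁻ ξ, ‖h ξ‖ₑ ^ 2) ^ (p / 2 : ℝ)
        * (2 * ∫⁻ ρ, ENNReal.ofReal (kerBound n L ρ) ^ (p / 2 : ℝ))) := by
  set d : ℕ → ℝ × hyperplane e := TopologicalSpace.denseSeq _ with hd
  set P : ℝ → ℝ × hyperplane e → ℝ × Eucl n := fun r y => (y.1, r • e + (y.2 : Eucl n)) with hP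
  have hPc : Continuous P.uncurry := by rw [hP]; fun_prop
  have hFc := continuous_freeEvo ε hc hi
  set f : ℝ → ℕ → ℝ≥0∞ := fun r k => ‖freeEvo ε h (P r (d k))‖ₑ with hf
  have hfm : ∀ k, Measurable fun r => f r k := fun k => by
    have : Continuous fun r => P r (d k) := hPc.comp (by fun_prop : Continuous fun r : ℝ => (r, d k))
    exact (hFc.comp this).measurable.enorm
  set S : ℝ → ℝ≥0∞ := fun r => ⨆ k, f r k with hS
  have hSm : Measurable S := Measurable.iSup hfm
  have hStop : ∀ r, S r ≠ ∞ := fun r => by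
    refine ne_top_of_le_ne_top (ENNReal.ofReal_ne_top (r := ∫ ξ, ‖h ξ‖)) (iSup_le fun k => ?_)
    simp only [hf]
    rw [← ofReal_norm]
    exact ENNReal.ofReal_le_ofReal (norm_freeEvo_le ε h _)
  have hex : ∀ r, ∃ k, S r ≤ 2 * f r k := fun r => by
    rcases eq_or_ne (S r) 0 with h0 | h0
    · exact ⟨0, by rw [h0]; exact zero_le⟩
    · obtain ⟨k, hk⟩ := lt_iSup_iff.1 (ENNReal.half_lt_self h0 (hStop r))
      refine ⟨k, ?_⟩
      rw [ENNReal.div_lt_iff (by simp) (by simp)] at hk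
      rw [mul_comm]; exact hk.le
  classical
  set κ : ℝ → ℕ := fun r => Nat.find (hex r) with hκ
  have hκm : Measurable κ := measurable_find hex fun k =>
    measurableSet_le hSm ((hfm k).const_mul 2)
  have hz : Measurable fun r => P r (d (κ r)) :=
    hPc.measurable.comp (measurable_id.prodMk ((measurable_of_countable d).comp hκm))
  have hzd : ∀ r s, |r - s| ≤ ‖(P r (d (κ r))).2 - (P s (d (κ s))).2‖ := fun r s => by
    have := abs_fst_le_norm_orthCoord he (r - s, (d (κ r)).2 - (d (κ s)).2)
    refine this.trans (le_of_eq ?_)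
    simp only [orthCoord, hP, Submodule.coe_sub, sub_smul]
    congr 1; abel
  have hin : ∀ r, innerQ ∞ e (freeEvo ε h) r ≤ 2 * f r (κ r) := fun r => by
    refine le_trans ?_ (Nat.find_spec (hex r))
    rw [innerQ, eLpNorm_exponent_top]
    refine eLpNormEssSup_le_of_ae_enorm_bound (Eventually.of_forall fun y => ?_)
    have hcl : IsClosed {y : ℝ × hyperplane e | ‖freeEvo ε h (P r y)‖ₑ ≤ S r} := by
      refine isClosed_le (Continuous.enorm (hFc.comp ?_)) continuous_const
      exact hPc.comp (by fun_prop : Continuous fun y : ℝ × hyperplane e => (r, y))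
    exact (TopologicalSpace.denseRange_denseSeq (ℝ × hyperplane e)).induction_on
      (p := fun y => ‖freeEvo ε h (P r y)‖ₑ ≤ S r) y hcl fun k => le_iSup (f r) k
  calc _ ≤ ∫⁻ r, 2 ^ p * ‖freeEvo ε h (P r (d (κ r)))‖ₑ ^ p := by
        refine lintegral_mono fun r => ?_
        rw [← mul_pow]
        exact pow_le_pow_left' (hin r) p
    _ = 2 ^ p * ∫⁻ r, ‖freeEvo ε h (P r (d (κ r)))‖ₑ ^ p :=
        lintegral_const_mul' _ _ (by finiteness)
    _ ≤ _ := by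
        gcongr
        exact lintegral_freeEvo_selection_le hn hε hp hL hc hi h2 hsupp hz hzd

/-- The maximal function estimate `‖W(t)h‖_{L^{p,∞}_e} ≲ L^{n/2-1/p} ‖h‖_{L²}`. -/
lemma exists_aniNorm_freeEvo_le (hn : 0 < n) (hε : ∀ i, ε i ^ 2 = 1) {p : ℕ} (hp : 2 ≤ p)
    (hnp : 4 < n * p) : ∃ C : ℝ, 0 < C ∧ ∀ (h : Eucl n → ℂ) (L : ℝ), 0 < L → Continuous h →
      Integrable h → MemLp h 2 → (∀ ξ, h ξ ≠ 0 → ‖ξ‖ ≤ 2 * L) → ∀ e : Eucl n, ‖e‖ = 1 →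
      aniNorm p ∞ e (freeEvo ε h)
        ≤ ENNReal.ofReal (C * L ^ (n / 2 - 1 / p : ℝ)) * eLpNorm h 2 volume := by
  obtain ⟨C, hC, hCK⟩ := exists_lintegral_kerBound_le n hnp
  have hp0 : (0 : ℝ) < p := by exact_mod_cast (by omega : 0 < p)
  refine ⟨2 * (Real.exp 4 * (2 * C) ^ (1 / p : ℝ)), by positivity, fun h L hL hc hi h2 hsupp e he => ?_⟩
  rw [aniNorm, if_neg (ENNReal.natCast_ne_top p), ENNReal.toReal_natCast]
  simp_rw [ENNReal.rpow_natCast]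
  have h1 := lintegral_iSup_freeEvo_le hn hε hp hL hc hi h2 hsupp he
  rw [lintegral_enorm_sq_eq_eLpNorm, ← mul_pow] at h1
  have hroot : ∀ a : ℝ≥0∞, (a ^ p) ^ (1 / p : ℝ) = a := fun a => by
    rw [← ENNReal.rpow_natCast, ← ENNReal.rpow_mul]; field_simp; simp
  have hroot2 : ∀ a : ℝ≥0∞, ((a ^ 2) ^ (p / 2 : ℝ)) ^ (1 / p : ℝ) = a := fun a => by
    rw [← ENNReal.rpow_natCast, ← ENNReal.rpow_mul, ← ENNReal.rpow_mul]; field_simp; simp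
  have hK : (2 * ∫⁻ ρ, ENNReal.ofReal (kerBound n L ρ) ^ (p / 2 : ℝ)) ^ (1 / p : ℝ)
      ≤ ENNReal.ofReal ((2 * C) ^ (1 / p : ℝ) * L ^ (n / 2 - 1 / p : ℝ)) := by
    calc _ ≤ (ENNReal.ofReal 2 * ENNReal.ofReal (C * L ^ (n * p / 2 - 1 : ℝ))) ^ (1 / p : ℝ) := by
          rw [ENNReal.ofReal_ofNat]
          gcongr
          exact hCK L hL
      _ = _ := by
          rw [← ENNReal.ofReal_mul (by norm_num),
            ENNReal.ofReal_rpow_of_nonneg (by positivity) (by positivity), ← mul_assoc,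
            Real.mul_rpow (by positivity) (by positivity), ← Real.rpow_mul hL.le]
          congr 3; field_simp
  calc _ ≤ (2 ^ p * (((ENNReal.ofReal (Real.exp 4) * eLpNorm h 2 volume) ^ 2) ^ (p / 2 : ℝ)
        * (2 * ∫⁻ ρ, ENNReal.ofReal (kerBound n L ρ) ^ (p / 2 : ℝ)))) ^ (1 / p : ℝ) := by gcongr
    _ = 2 * (ENNReal.ofReal (Real.exp 4) * eLpNorm h 2 volume
        * (2 * ∫⁻ ρ, ENNReal.ofReal (kerBound n L ρ) ^ (p / 2 : ℝ)) ^ (1 / p : ℝ)) := by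
        rw [ENNReal.mul_rpow_of_nonneg _ _ (by positivity),
          ENNReal.mul_rpow_of_nonneg _ _ (by positivity), hroot, hroot2]
    _ ≤ 2 * (ENNReal.ofReal (Real.exp 4) * eLpNorm h 2 volume
        * ENNReal.ofReal ((2 * C) ^ (1 / p : ℝ) * L ^ (n / 2 - 1 / p : ℝ))) := by gcongr
    _ = _ := by
        rw [mul_assoc 2, mul_assoc (Real.exp 4), ENNReal.ofReal_mul (by norm_num : (0 : ℝ) ≤ 2),
          ENNReal.ofReal_mul (Real.exp_pos 4).le, ENNReal.ofReal_ofNat]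
        ring

end Maximal

section Multipliers

variable {n : ℕ}

lemma continuous_fourier (f : Eucl n → ℂ) : Continuous (𝓕 f) := by
  by_cases hf : Integrable f
  · exact continuous_fourier_of_integrable hf
  · have : 𝓕 f = 0 := funext fun ξ => by
      rw [Real.fourier_eq]
      refine integral_undef fun h => hf ?_
      exact (Real.fourierIntegral_convergent_iff ξ).1 h
    rw [this]; exact continuous_zero

lemma mulOp_zero (m₁ : Eucl n → ℂ) : mulOp m₁ 0 = 0 := by
  have h1 : 𝓕 (0 : Eucl n → ℂ) = 0 := funext fun ξ => by simp [Real.fourier_eq]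
  funext x
  simp [mulOp, h1, Real.fourierInv_eq]

/-- A multiplier acting on the inverse Fourier transform of a continuous function. -/
lemma mulOp_fourierInv {H : Eucl n → ℂ} (hH : Continuous H) (m₁ : Eucl n → ℂ) :
    mulOp m₁ (𝓕⁻ H) = 𝓕⁻ (fun ξ => m₁ ξ * H ξ) ∨ mulOp m₁ (𝓕⁻ H) = 0 := by
  by_cases h1 : Integrable H
  · by_cases h2 : Integrable (𝓕⁻ H)
    · left
      have h3 : Integrable (𝓕 H) := by
        have := h2.comp_neg
        refine this.congr (Eventually.of_forall fun x => ?_)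
        simp [Real.fourierInv_eq_fourier_neg]
      rw [mulOp, hH.fourier_fourierInv_eq h1 h3]
    · right
      have h3 : 𝓕 (𝓕⁻ H) = 0 := funext fun ξ => by
        rw [Real.fourier_eq]
        exact integral_undef fun h => h2 ((Real.fourierIntegral_convergent_iff ξ).1 h)
      funext x
      simp [mulOp, h3, Real.fourierInv_eq]
  · right
    have h3 : 𝓕⁻ H = 0 := funext fun x => by
      rw [Real.fourierInv_eq_fourier_neg, Real.fourier_eq]
      exact integral_undef fun h => h1 ((Real.fourierIntegral_convergent_iff (-x)).1 h)
    rw [h3, mulOp_zero]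

end Multipliers

section Bump

variable {χ : ℝ → ℝ}

lemma IsBump.continuous (hχ : IsBump χ) : Continuous χ := (hχ.smooth 0).continuous

lemma IsBump.exists_bound (hχ : IsBump χ) : ∃ B : ℝ, 0 < B ∧ ∀ s, |χ s| ≤ B := by
  obtain ⟨B, hB⟩ := (isCompact_Icc (a := (-2 : ℝ)) (b := 2)).exists_bound_of_continuousOn
    hχ.continuous.continuousOn
  refine ⟨max B 1, by positivity, fun s => ?_⟩
  rcases le_or_gt 2 |s| with h | h
  · rw [hχ.supp s h, abs_zero]; positivity
  · exact (hB s ⟨by linarith [neg_abs_le s], by linarith [le_abs_self s]⟩).trans (le_max_left _ _)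

lemma IsBump.psiGe_eq (hχ : IsBump χ) (k : ℤ) (s : ℝ) :
    psiGe χ k s = 1 - χ (2 ^ (1 - k) * |s|) := by
  set b : ℕ → ℝ := fun i => χ (2 ^ (1 - k - i) * |s|) with hb
  have hinj : Function.Injective fun i : ℕ => k + (i : ℤ) := fun i j h => by
    simpa using h
  obtain ⟨N, hN⟩ := pow_unbounded_of_one_lt ((2 : ℝ) ^ (1 - k) * |s|) (one_lt_two)
  have hone : ∀ i, N ≤ i → b i = 1 := fun i hi => by
    refine hχ.one _ ?_
    rw [abs_of_nonneg (by positivity), zpow_sub₀ two_ne_zero, zpow_natCast, div_mul_eq_mul_div,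
      div_le_one (by positivity)]
    exact hN.le.trans (pow_le_pow_right₀ one_le_two hi)
  rw [psiGe, ← hinj.tsum_eq]
  · have hterm : ∀ i : ℕ, (if k ≤ k + (i : ℤ) then psiR χ ((2 : ℝ) ^ (-(k + (i : ℤ))) * s) else 0)
        = b (i + 1) - b i := fun i => by
      rw [if_pos (by omega), psiR, hb, abs_mul, abs_of_pos (by positivity : (0 : ℝ) < 2 ^ (-(k + (i : ℤ))))]
      congr 2
      · congr 2; push_cast; ring
      · rw [← mul_assoc, ← zpow_one_add₀ two_ne_zero]
        congr 2; ring
    simp_rw [hterm]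
    rw [tsum_eq_sum (s := Finset.range N) fun i hi => by
      rw [Finset.mem_range, not_lt] at hi
      rw [hone i hi, hone (i + 1) (by omega), sub_self], Finset.sum_range_sub, hone N le_rfl]
    simp [hb]
  · intro m hm
    rw [Function.mem_support] at hm
    have : k ≤ m := by by_contra h; simp [h] at hm
    exact ⟨(m - k).toNat, by simp only; omega⟩

lemma IsBump.continuous_psiGe (hχ : IsBump χ) (k : ℤ) : Continuous (psiGe χ k) := by
  have : psiGe χ k = fun s => 1 - χ (2 ^ (1 - k) * |s|) := funext (hχ.psiGe_eq k)
  rw [this]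
  exact continuous_const.sub (hχ.continuous.comp (by fun_prop))

lemma IsBump.lt_abs_of_psiGe_ne_zero (hχ : IsBump χ) {k : ℤ} {s : ℝ} (h : psiGe χ k s ≠ 0) :
    2 ^ k < |2 * s| := by
  by_contra! hs
  refine h ?_
  rw [hχ.psiGe_eq, hχ.one, sub_self]
  rw [abs_mul, abs_two] at hs
  rw [abs_of_nonneg (by positivity), zpow_sub₀ two_ne_zero, zpow_one, div_mul_eq_mul_div,
    div_le_one (by positivity)]
  exact hs

lemma IsBump.continuous_psiR (hχ : IsBump χ) : Continuous (psiR χ) := by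
  have := hχ.continuous
  unfold psiR
  exact (this.comp (by fun_prop)).sub (this.comp (by fun_prop))

lemma IsBump.abs_lt_of_psiR_ne_zero (hχ : IsBump χ) {s : ℝ} (h : psiR χ s ≠ 0) : |s| < 2 := by
  by_contra! hs
  refine h ?_
  rw [psiR, hχ.supp _ (by rwa [abs_abs]), hχ.supp, sub_self]
  rw [abs_mul, abs_two, abs_abs]; linarith

end Bump

section Norms

variable {n : ℕ}

lemma innerQ_mono {u v : ℝ × Eucl n → ℂ} (h : ∀ z, ‖u z‖ ≤ ‖v z‖) (q : ℝ≥0∞) (e : Eucl n)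
    (r : ℝ) : innerQ q e u r ≤ innerQ q e v r :=
  eLpNorm_mono fun _ => h _

lemma aniNorm_mono {u v : ℝ × Eucl n → ℂ} (h : ∀ z, ‖u z‖ ≤ ‖v z‖) (p q : ℝ≥0∞) (e : Eucl n) :
    aniNorm p q e u ≤ aniNorm p q e v := by
  unfold aniNorm
  split_ifs
  · exact essSup_mono_ae (Eventually.of_forall fun r => innerQ_mono h q e r)
  · gcongr
    exact innerQ_mono h q e _

lemma sphSup_le {g : Eucl n → ℝ≥0∞} {c : ℝ≥0∞} (h : ∀ e, ‖e‖ = 1 → g e ≤ c) : sphSup g ≤ c :=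
  iSup₂_le h

/-- Local smoothing in the `L^{∞,2}_e` norm. -/
lemma aniNorm_top_two_freeEvo_le (ε : Fin n → ℝ) {h : Eucl n → ℂ}
    (hc : Continuous h) (hs : HasCompactSupport h) {δ : ℝ} (hδ : 0 < δ) {e : Eucl n} (he : ‖e‖ = 1)
    (hsupp : ∀ ξ, h ξ ≠ 0 → δ ≤ |2 * ⟪ξ, epm ε e⟫|) :
    aniNorm ∞ 2 e (freeEvo ε h)
      ≤ ENNReal.ofReal (Real.sqrt (4 * Real.pi / δ)) * eLpNorm h 2 volume := by
  rw [aniNorm, if_pos rfl]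
  refine essSup_le_of_ae_le _ (Eventually.of_forall fun r => ?_)
  have h1 := lintegral_hyperplane_freeEvo_le ε hc hs hδ he hsupp r
  rw [lintegral_enorm_sq_eq_eLpNorm, lintegral_enorm_sq_eq_eLpNorm] at h1
  have h2 : ENNReal.ofReal (4 * Real.pi / δ) = ENNReal.ofReal (Real.sqrt (4 * Real.pi / δ)) ^ 2 := by
    rw [← ENNReal.ofReal_pow (Real.sqrt_nonneg _), Real.sq_sqrt (by positivity)]
  rw [h2, ← mul_pow] at h1
  exact (ENNReal.pow_le_pow_left_iff two_ne_zero).1 h1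

lemma mixNorm_top_two_freeEvo_le (ε : Fin n → ℝ) {h : Eucl n → ℂ}
    (hc : Continuous h) (hs : HasCompactSupport h) :
    mixNorm ∞ 2 (freeEvo ε h) ≤ eLpNorm h 2 volume := by
  rw [mixNorm, if_pos rfl]
  refine essSup_le_of_ae_le _ (Eventually.of_forall fun t => ?_)
  have hq := continuous_quadSym ε
  have hc' : Continuous fun ξ => cexp (-I * t * quadSym ε ξ) * h ξ := by fun_prop
  have hs' : HasCompactSupport fun ξ => cexp (-I * t * quadSym ε ξ) * h ξ := hs.mul_left
  change eLpNorm (𝓕⁻ fun ξ => cexp (-I * t * quadSym ε ξ) * h ξ) 2 volume ≤ _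
  rw [eLpNorm_fourierInv_eq (hc'.integrable_of_hasCompactSupport hs')
    (hc'.memLp_of_hasCompactSupport hs')]
  exact eLpNorm_mono fun ξ => by rw [norm_mul, norm_cexp_quadSym, one_mul]

end Norms

section Assembly

variable {n : ℕ} {χ : ℝ → ℝ}

/-- The frequency profile of `P_j φ`. -/
def lpProfile (χ : ℝ → ℝ) (j : ℤ) (φ : Eucl n → ℂ) (ξ : Eucl n) : ℂ :=
  (psiR χ ((2 : ℝ) ^ (-j) * ‖ξ‖) : ℂ) * 𝓕 φ ξ

lemma IsBump.continuous_lpProfile (hχ : IsBump χ) (j : ℤ) (φ : Eucl n → ℂ) :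
    Continuous (lpProfile χ j φ) := by
  have h1 : Continuous fun ξ : Eucl n => psiR χ ((2 : ℝ) ^ (-j) * ‖ξ‖) :=
    hχ.continuous_psiR.comp (by fun_prop)
  exact (continuous_ofReal.comp h1).mul (continuous_fourier φ)

lemma IsBump.norm_le_of_lpProfile_ne_zero (hχ : IsBump χ) {j : ℤ} {φ : Eucl n → ℂ} {ξ : Eucl n}
    (h : lpProfile χ j φ ξ ≠ 0) : ‖ξ‖ ≤ 2 * 2 ^ j := by
  have h1 : psiR χ ((2 : ℝ) ^ (-j) * ‖ξ‖) ≠ 0 := fun h0 =>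
    h (by rw [lpProfile, h0, ofReal_zero, zero_mul])
  have h2 := hχ.abs_lt_of_psiR_ne_zero h1
  rw [abs_of_nonneg (by positivity), zpow_neg, inv_mul_lt_iff₀ (by positivity)] at h2
  linarith

lemma IsBump.hasCompactSupport_lpProfile (hχ : IsBump χ) (j : ℤ) (φ : Eucl n → ℂ) :
    HasCompactSupport (lpProfile χ j φ) := by
  refine HasCompactSupport.intro (isCompact_closedBall 0 (2 * (2 : ℝ) ^ j)) fun ξ hξ => ?_
  by_contra h
  exact hξ (by simpa using hχ.norm_le_of_lpProfile_ne_zero h)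

lemma IsBump.eLpNorm_proj (hχ : IsBump χ) (j : ℤ) (φ : Eucl n → ℂ) :
    eLpNorm (proj χ j φ) 2 volume = eLpNorm (lpProfile χ j φ) 2 volume := by
  have hc := hχ.continuous_lpProfile j φ
  have hs := hχ.hasCompactSupport_lpProfile j φ
  exact eLpNorm_fourierInv_eq (hc.integrable_of_hasCompactSupport hs)
    (hc.memLp_of_hasCompactSupport hs)

lemma norm_projT_prop_le (ε : Fin n → ℝ) (χ : ℝ → ℝ) (j : ℤ) (φ : Eucl n → ℂ) (z : ℝ × Eucl n) :
    ‖projT χ j (fun p => prop ε p.1 φ p.2) z‖ ≤ ‖freeEvo ε (lpProfile χ j φ) z‖ := by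
  have hq := continuous_quadSym ε
  have hf := continuous_fourier φ
  rcases mulOp_fourierInv (H := fun ξ => cexp (-I * z.1 * quadSym ε ξ) * 𝓕 φ ξ) (by fun_prop)
    (fun ξ => (psiR χ ((2 : ℝ) ^ (-j) * ‖ξ‖) : ℂ)) with h | h
  · refine le_of_eq ?_
    rw [freeEvo]
    refine congrArg norm ((congrFun h z.2).trans ?_)
    refine congrArg (fun G : Eucl n → ℂ => 𝓕⁻ G z.2) (funext fun ξ => ?_)
    rw [lpProfile]; ring
  · refine (congrArg norm (congrFun h z.2)).le.trans ?_
    simp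

lemma IsBump.norm_projT_qprojT_prop_le (hχ : IsBump χ) (ε : Fin n → ℝ) (e : Eucl n) (j l : ℤ)
    (φ : Eucl n → ℂ) (z : ℝ × Eucl n) :
    ‖projT χ j (qprojT χ e j l (fun p => prop ε p.1 φ p.2)) z‖
      ≤ ‖freeEvo ε (fun ξ => ((psiGe χ (j - l) ⟪ξ, e⟫ : ℝ) : ℂ) * lpProfile χ j φ ξ) z‖ := by
  have hq := continuous_quadSym ε
  have hf := continuous_fourier φ
  have hb : Continuous fun ξ : Eucl n => ((psiGe χ (j - l) ⟪ξ, e⟫ : ℝ) : ℂ) :=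
    continuous_ofReal.comp ((hχ.continuous_psiGe _).comp (by fun_prop))
  have h0 : ∀ x : Eucl n, mulOp (fun ξ => (psiR χ ((2 : ℝ) ^ (-j) * ‖ξ‖) : ℂ)) 0 x = 0 := fun x =>
    congrFun (mulOp_zero _) x
  rw [projT, proj]
  have hcase : (fun y => qprojT χ e j l (fun p => prop ε p.1 φ p.2) (z.1, y))
      = 𝓕⁻ (fun ξ => ((psiGe χ (j - l) ⟪ξ, e⟫ : ℝ) : ℂ)
          * (cexp (-I * z.1 * quadSym ε ξ) * 𝓕 φ ξ))
      ∨ (fun y => qprojT χ e j l (fun p => prop ε p.1 φ p.2) (z.1, y)) = 0 :=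
    mulOp_fourierInv (H := fun ξ => cexp (-I * z.1 * quadSym ε ξ) * 𝓕 φ ξ) (by fun_prop) _
  rcases hcase with h | h
  · rw [h]
    rcases mulOp_fourierInv (H := fun ξ => ((psiGe χ (j - l) ⟪ξ, e⟫ : ℝ) : ℂ)
          * (cexp (-I * z.1 * quadSym ε ξ) * 𝓕 φ ξ)) (by fun_prop)
        (fun ξ => (psiR χ ((2 : ℝ) ^ (-j) * ‖ξ‖) : ℂ)) with h' | h'
    · refine le_of_eq ?_
      rw [freeEvo]
      refine congrArg norm ((congrFun h' z.2).trans ?_)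
      refine congrArg (fun G : Eucl n → ℂ => 𝓕⁻ G z.2) (funext fun ξ => ?_)
      rw [lpProfile]; ring
    · refine (congrArg norm (congrFun h' z.2)).le.trans ?_
      simp
  · rw [h, h0, norm_zero]; exact norm_nonneg _

lemma tp_mul_ofReal_zpow (a C : ℝ) (j : ℤ) :
    tp (-a * j) * ENNReal.ofReal (C * ((2 : ℝ) ^ j) ^ a) = ENNReal.ofReal C := by
  rw [tp, ← ENNReal.ofReal_mul (by positivity)]
  congr 1
  rw [← Real.rpow_intCast, ← Real.rpow_mul zero_le_two, mul_left_comm,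
    ← Real.rpow_add two_pos]
  have : -a * j + j * a = 0 := by ring
  rw [this, Real.rpow_zero, mul_one]

lemma exists_MmJ_le (hn : 0 < n) {ε : Fin n → ℝ} (hε : ∀ i, ε i ^ 2 = 1) (hχ : IsBump χ)
    {m : ℕ} (hm : 3 ≤ m) (hnm : 4 < n * (m - 1)) : ∃ C : ℝ, 0 < C ∧ ∀ (j : ℤ) (φ : Eucl n → ℂ),
      MmJ χ m j (fun p => prop ε p.1 φ p.2)
        ≤ ENNReal.ofReal C * eLpNorm (lpProfile χ j φ) 2 volume := by
  obtain ⟨C, hC, hCM⟩ := exists_aniNorm_freeEvo_le hn hε (p := m - 1) (by omega) hnm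
  refine ⟨C, hC, fun j φ => ?_⟩
  have hc := hχ.continuous_lpProfile j φ
  have hs := hχ.hasCompactSupport_lpProfile j φ
  have hcast : ((m - 1 : ℕ) : ℝ) = (m : ℝ) - 1 := by rw [Nat.cast_sub (by omega)]; simp
  have hcast' : ((m - 1 : ℕ) : ℝ≥0∞) = (m : ℝ≥0∞) - 1 := by simp
  rw [hcast, hcast'] at hCM
  rw [MmJ, ← tp_mul_ofReal_zpow ((n : ℝ) / 2 - 1 / ((m : ℝ) - 1)) C j, mul_assoc]
  gcongr
  refine sphSup_le fun e he => (aniNorm_mono (norm_projT_prop_le ε χ j φ) _ _ e).trans ?_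
  exact hCM _ _ (by positivity) hc (hc.integrable_of_hasCompactSupport hs)
    (hc.memLp_of_hasCompactSupport hs) (fun ξ h => hχ.norm_le_of_lpProfile_ne_zero h) e he

lemma exists_SJ_le (ε : Fin n → ℝ) (hχ : IsBump χ) : ∃ C : ℝ, 0 < C ∧
    ∀ (j : ℤ) (φ : Eucl n → ℂ), SJ ε χ j (fun p => prop ε p.1 φ p.2)
      ≤ ENNReal.ofReal C * eLpNorm (lpProfile χ j φ) 2 volume := by
  obtain ⟨B, hB, hχB⟩ := hχ.exists_bound
  refine ⟨Real.sqrt (4 * Real.pi * 2 ^ (20 : ℤ)) * (1 + B), by positivity, fun j φ => ?_⟩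
  have hc := hχ.continuous_lpProfile j φ
  have hs := hχ.hasCompactSupport_lpProfile j φ
  have hconst : tp ((j : ℝ) / 2) * ENNReal.ofReal (Real.sqrt (4 * Real.pi / 2 ^ (j - 20)))
      = ENNReal.ofReal (Real.sqrt (4 * Real.pi * 2 ^ (20 : ℤ))) := by
    have h1 : (2 : ℝ) ^ ((j : ℝ) / 2) = Real.sqrt (2 ^ j) := by
      rw [Real.sqrt_eq_rpow, ← Real.rpow_intCast, ← Real.rpow_mul zero_le_two]
      congr 1; ring
    rw [tp, ← ENNReal.ofReal_mul (by positivity), h1, ← Real.sqrt_mul (by positivity)]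
    congr 2
    rw [zpow_sub₀ two_ne_zero]
    field_simp
  rw [SJ, ENNReal.ofReal_mul (Real.sqrt_nonneg _), ← hconst, mul_assoc, mul_assoc]
  gcongr
  refine sphSup_le fun e he =>
    (aniNorm_mono (hχ.norm_projT_qprojT_prop_le ε (epm ε e) j 20 φ) _ _ e).trans ?_
  have hb : Continuous fun ξ : Eucl n => ((psiGe χ (j - 20) ⟪ξ, epm ε e⟫ : ℝ) : ℂ) :=
    continuous_ofReal.comp ((hχ.continuous_psiGe _).comp (by fun_prop))
  refine (aniNorm_top_two_freeEvo_le ε (hb.mul hc) hs.mul_left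
    (by positivity : (0 : ℝ) < 2 ^ (j - 20)) he fun ξ h => ?_).trans ?_
  · have h1 : psiGe χ (j - 20) ⟪ξ, epm ε e⟫ ≠ 0 := fun h0 => h (by simp [h0])
    exact (hχ.lt_abs_of_psiGe_ne_zero h1).le
  · gcongr
    refine eLpNorm_le_mul_eLpNorm_of_ae_le_mul (Eventually.of_forall fun ξ => ?_) 2
    rw [Pi.mul_apply, norm_mul, Complex.norm_real, Real.norm_eq_abs, hχ.psiGe_eq]
    gcongr
    refine (abs_sub _ _).trans ?_
    rw [abs_one]
    gcongr
    exact hχB _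

lemma IsBump.TJ_le (hχ : IsBump χ) (ε : Fin n → ℝ) (j : ℤ) (φ : Eucl n → ℂ) :
    TJ χ j (fun p => prop ε p.1 φ p.2) ≤ eLpNorm (lpProfile χ j φ) 2 volume := by
  refine le_trans ?_ (mixNorm_top_two_freeEvo_le ε (hχ.continuous_lpProfile j φ)
    (hχ.hasCompactSupport_lpProfile j φ))
  rw [TJ, mixNorm, mixNorm, if_pos rfl, if_pos rfl]
  exact essSup_mono_ae (Eventually.of_forall fun t =>
    eLpNorm_mono fun x => norm_projT_prop_le ε χ j φ (t, x))

end Assembly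

end DNLS

/-- `‖W_±(t)φ‖_{Ż^σ_{2,1}} ≤ C‖φ‖_{Ḃ^σ_{2,1}}`. -/
theorem free_evolution_resolution_norm
    (n : ℕ) (hn : 2 ≤ n) (ε : Fin n → ℝ) (hε : ∀ i, ε i = 1 ∨ ε i = -1)
    (χ : ℝ → ℝ) (hχ : IsBump χ)
    (m : ℕ) (hm : 3 ≤ m) (hnm : 6 ≤ n * (m - 1)) :
    ∀ σ : ℝ, 0 ≤ σ → ∃ C : ℝ, 0 < C ∧ ∀ φ : Eucl n → ℂ, homBesov χ σ φ < ∞ →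
      Zhom ε χ m σ (fun p : ℝ × Eucl n => prop ε p.1 φ p.2)
      ≤ ENNReal.ofReal C * homBesov χ σ φ := by
  intro σ _
  have hε2 : ∀ i, ε i ^ 2 = 1 := fun i => by rcases hε i with h | h <;> rw [h] <;> norm_num
  obtain ⟨C₁, hC₁, hM⟩ := exists_MmJ_le (by omega) hε2 hχ hm (by omega)
  obtain ⟨C₂, hC₂, hS⟩ := exists_SJ_le ε hχ
  refine ⟨C₁ + C₂ + 1, by positivity, fun φ _ => ?_⟩
  rw [Zhom, homBesov, ← ENNReal.tsum_mul_left]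
  refine ENNReal.tsum_le_tsum fun j => ?_
  rw [mul_left_comm, hχ.eLpNorm_proj]
  gcongr
  rw [ENNReal.ofReal_add (by positivity) zero_le_one, ENNReal.ofReal_add hC₁.le hC₂.le,
    ENNReal.ofReal_one, add_mul, add_mul, one_mul, YmJ]
  exact add_le_add (add_le_add (hM j φ) (hS j φ)) (hχ.TJ_le ε j φ)
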